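/- arXiv:0705.2546 — 2 statements merged into one kernel-verified Lean document; each statement's English description precedes it below -/
import Mathlib

section
/- Let A and B be finitely generated groups and let C be a common subgroup of A and B. Then asdim(A *_C B) ≤ max{asdim A, asdim B, asdim C + 1}, where A and B carry their word metrics, A *_C B carries the word metric of the generating set S_A ∪ S_B, and C carries the metric restricted from A *_C B. -/
/-- `AsdimLE d n` : the asymptotic dimension of the space `X` with distance
function `d` is at most `n`: for every `r > 0` there are `n + 1` families of
`r`-disjoint, uniformly bounded subsets of `X` which together cover `X`. -/
def AsdimLE {X : Type*} (d : X → X → ℝ) (n : ℕ) : Prop :=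
  ∀ r : ℝ, 0 < r → ∃ (𝒰 : Fin (n + 1) → Set (Set X)) (D : ℝ),
    (∀ i, ∀ U ∈ 𝒰 i, ∀ V ∈ 𝒰 i, U ≠ V → ∀ x ∈ U, ∀ y ∈ V, r ≤ d x y) ∧
    (∀ i, ∀ U ∈ 𝒰 i, ∀ x ∈ U, ∀ y ∈ U, d x y ≤ D) ∧
    (∀ x : X, ∃ i, ∃ U ∈ 𝒰 i, x ∈ U)

/-- The asymptotic dimension of the space `X` with distance function `d`,
as an extended natural number: the least `n` with `AsdimLE d n` (`⊤` if none). -/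
noncomputable def asDim {X : Type*} (d : X → X → ℝ) : ℕ∞ :=
  sInf {N : ℕ∞ | ∃ n : ℕ, N = (n : ℕ∞) ∧ AsdimLE d n}

/-- The word norm of `g` with respect to the generating set `S`. -/
noncomputable def wordNorm {G : Type*} [Group G] (S : Set G) (g : G) : ℕ :=
  sInf {k : ℕ | ∃ l : List G, l.length = k ∧ (∀ x ∈ l, x ∈ S) ∧ l.prod = g}

/-- The word metric on `G` associated with the generating set `S`. -/
noncomputable def wordDist {G : Type*} [Group G] (S : Set G) (g h : G) : ℝ :=
  (wordNorm S (g⁻¹ * h) : ℝ)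

/-- `G` is the amalgamated free product `A *_C B` of its subgroups `A` and `B`
over the common subgroup `C`: `A` and `B` generate `G`, and any pair of
homomorphisms on `A` and `B` agreeing on `C` extends to `G` (this universal
property, together with the generation condition, characterizes `A *_C B`). -/
def IsAmalgamatedProduct (G : Type*) [Group G] (A B C : Subgroup G) : Prop :=
  C ≤ A ∧ C ≤ B ∧ Subgroup.closure ((A : Set G) ∪ (B : Set G)) = ⊤ ∧
  ∀ {H : Type*} [Group H] (fA : A →* H) (fB : B →* H),
    (∀ (x : G) (hxA : x ∈ A) (hxB : x ∈ B), x ∈ C → fA ⟨x, hxA⟩ = fB ⟨x, hxB⟩) →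
    ∃ f : G →* H, (∀ a : A, f ↑a = fA a) ∧ (∀ b : B, f ↑b = fB b)

namespace AmalgAsdim

/-- Coloured and labelled description of a cover of `Y` at scale `r` with pieces bounded by `D`;
the colour of `x` is less than `N x`. -/
def Cov {X : Type*} (d : X → X → ℝ) (Y : Set X) (N : X → ℕ) (r D : ℝ) : Prop :=
  ∃ (c : X → ℕ) (l : X → X), ∀ x ∈ Y, c x < N x ∧ ∀ y ∈ Y, c x = c y →
    (l x = l y → d x y ≤ D) ∧ (l x ≠ l y → r ≤ d x y)

theorem Cov.of_labels {X L : Type*} {d : X → X → ℝ} {Y : Set X} {N : X → ℕ} {r D : ℝ}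
    (c : X → ℕ) (l : X → L)
    (h : ∀ x ∈ Y, c x < N x ∧ ∀ y ∈ Y, c x = c y →
      (l x = l y → d x y ≤ D) ∧ (l x ≠ l y → r ≤ d x y)) : Cov d Y N r D := by
  classical
  let q : X → ℕ × L := fun x => (c x, l x)
  let l' : X → X := fun x => if h : ∃ y ∈ Y, q y = q x then h.choose else x
  have hl' : ∀ x ∈ Y, q (l' x) = q x := by
    intro x hx
    have hh : ∃ y ∈ Y, q y = q x := ⟨x, hx, rfl⟩
    simp only [l', dif_pos hh]
    exact hh.choose_spec.2
  have hl2 : ∀ x ∈ Y, ∀ y ∈ Y, q x = q y → l' x = l' y := by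
    intro x hx y hy hxy
    have h1 : ∃ z ∈ Y, q z = q x := ⟨x, hx, rfl⟩
    have h2 : ∃ z ∈ Y, q z = q y := ⟨y, hy, rfl⟩
    simp only [l', dif_pos h1, dif_pos h2]
    congr 1
    simp [hxy]
  refine ⟨c, l', fun x hx => ⟨(h x hx).1, fun y hy hc => ⟨fun e => ?_, fun e => ?_⟩⟩⟩
  · have : q x = q y := by rw [← hl' x hx, ← hl' y hy, e]
    exact ((h x hx).2 y hy hc).1 (congrArg Prod.snd this)
  · refine ((h x hx).2 y hy hc).2 (fun e' => e (hl2 x hx y hy (Prod.ext hc e')))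

theorem Cov.mono {X : Type*} {d : X → X → ℝ} {Y Y' : Set X} {N N' : X → ℕ} {r r' D D' : ℝ}
    (h : Cov d Y N r D) (hY : Y' ⊆ Y) (hN : ∀ x ∈ Y', N x ≤ N' x) (hr : r' ≤ r) (hD : D ≤ D') :
    Cov d Y' N' r' D' := by
  obtain ⟨c, l, h⟩ := h
  refine ⟨c, l, fun x hx => ⟨(h x (hY hx)).1.trans_le (hN x hx), fun y hy hc => ⟨fun e => ?_, fun e => ?_⟩⟩⟩
  · exact (((h x (hY hx)).2 y (hY hy) hc).1 e).trans hD
  · exact hr.trans (((h x (hY hx)).2 y (hY hy) hc).2 e)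

theorem Cov.disjUnion {X ι : Type*} {d : X → X → ℝ} {Y : Set X} {N : X → ℕ} {r D : ℝ}
    (α : X → ι) (h : ∀ i, Cov d {x | x ∈ Y ∧ α x = i} N r D)
    (hd : ∀ x ∈ Y, ∀ y ∈ Y, α x ≠ α y → r ≤ d x y) : Cov d Y N r D := by
  choose c l h using h
  refine Cov.of_labels (fun x => c (α x) x) (fun x => (α x, l (α x) x)) ?_
  intro x hx
  refine ⟨(h (α x) x ⟨hx, rfl⟩).1, fun y hy hc => ⟨fun e => ?_, fun e => ?_⟩⟩
  · obtain ⟨e1, e2⟩ := Prod.mk.inj e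
    refine ((h (α x) x ⟨hx, rfl⟩).2 y ⟨hy, e1.symm⟩ ?_).1 ?_
    · simp only [hc]; rw [e1]
    · rw [e2, e1]
  · by_cases e1 : α x = α y
    · refine ((h (α x) x ⟨hx, rfl⟩).2 y ⟨hy, e1.symm⟩ ?_).2 ?_
      · simp only [hc]; rw [e1]
      · intro e2; exact e (Prod.ext e1 (by simp only [e2]; rw [e1]))
    · exact hd x hx y hy e1

theorem Cov.pullback {X X' : Type*} {d : X → X → ℝ} {d' : X' → X' → ℝ} {Y : Set X} {Y' : Set X'}
    {N : ℕ} {r D r' D' : ℝ} (h : Cov d Y (fun _ => N) r D) (f : X' → X)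
    (hf : ∀ x ∈ Y', f x ∈ Y)
    (hD : ∀ x ∈ Y', ∀ y ∈ Y', d (f x) (f y) ≤ D → d' x y ≤ D')
    (hr : ∀ x ∈ Y', ∀ y ∈ Y', r ≤ d (f x) (f y) → r' ≤ d' x y) :
    Cov d' Y' (fun _ => N) r' D' := by
  obtain ⟨c, l, h⟩ := h
  refine Cov.of_labels (fun x => c (f x)) (fun x => l (f x)) (fun x hx => ⟨(h _ (hf x hx)).1,
    fun y hy hc => ⟨fun e => hD x hx y hy ?_, fun e => hr x hx y hy ?_⟩⟩)
  · exact ((h _ (hf x hx)).2 _ (hf y hy) hc).1 e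
  · exact ((h _ (hf x hx)).2 _ (hf y hy) hc).2 e

theorem Cov.union {X : Type*} [PseudoMetricSpace X] {Y0 Y1 : Set X} {N : X → ℕ} {r r1 D0 D1 : ℝ}
    (h0 : Cov dist Y0 N r D0) (h1 : Cov dist Y1 N r1 D1) (hr : 0 < r) (hD0 : 0 ≤ D0)
    (hD1 : 0 ≤ D1) (hr1 : D0 + 2 * r < r1) :
    Cov dist (Y0 ∪ Y1) N r (D1 + 2 * (D0 + r)) := by
  classical
  obtain ⟨c0, l0, h0⟩ := h0
  obtain ⟨c1, l1, h1⟩ := h1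
  let P : ℕ → X → X → Prop := fun k p m => ∃ z ∈ Y0, ∃ y ∈ Y1, c0 z = k ∧ l0 z = p ∧ c1 y = k ∧
    dist z y < r ∧ l1 y = m
  let c : X → ℕ := fun x => if x ∈ Y1 then c1 x else c0 x
  let l : X → X ⊕ X := fun x => if x ∈ Y1 then Sum.inl (l1 x) else
    if h : ∃ m, P (c0 x) (l0 x) m then Sum.inl h.choose else Sum.inr (l0 x)
  have key1 : ∀ x ∈ Y0 ∪ Y1, ∀ m, l x = Sum.inl m →
      ∃ y ∈ Y1, c1 y = c x ∧ l1 y = m ∧ dist x y ≤ D0 + r := by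
    intro x hx m hm
    by_cases hx1 : x ∈ Y1
    · simp only [l, if_pos hx1, Sum.inl.injEq] at hm
      exact ⟨x, hx1, by simp [c, hx1], hm, by simp; positivity⟩
    · have hx0 : x ∈ Y0 := hx.resolve_right hx1
      by_cases h : ∃ m, P (c0 x) (l0 x) m
      · simp only [l, if_neg hx1, dif_pos h, Sum.inl.injEq] at hm
        obtain ⟨z, hz, y, hy, e1, e2, e3, e4, e5⟩ := h.choose_spec
        refine ⟨y, hy, by simp [c, hx1, e3], e5.trans hm, ?_⟩
        have := ((h0 x hx0).2 z hz e1.symm).1 e2.symm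
        linarith [dist_triangle x z y]
      · simp only [l, if_neg hx1, dif_neg h] at hm
        exact absurd hm (by simp)
  have key2 : ∀ x ∈ Y1, ∀ y ∈ Y0, y ∉ Y1 → c1 x = c0 y → dist x y < r → l x = l y := by
    intro x hx y hy hy1 hc hd
    have h : ∃ m, P (c0 y) (l0 y) m :=
      ⟨l1 x, y, hy, x, hx, rfl, rfl, hc, by rwa [dist_comm], rfl⟩
    simp only [l, if_pos hx, if_neg hy1, dif_pos h]
    congr 1
    obtain ⟨z', hz', y', hy', e1, e2, e3, e4, e5⟩ := h.choose_spec
    rw [← e5]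
    by_contra hne
    have h3 := ((h1 x hx).2 y' hy' (hc.trans e3.symm)).2 hne
    have h4 := ((h0 y hy).2 z' hz' e1.symm).1 e2.symm
    linarith [dist_triangle x y y', dist_triangle y z' y']
  refine Cov.of_labels c l (fun x hx => ⟨?_, fun y hy hc => ⟨fun e => ?_, fun e => ?_⟩⟩)
  · by_cases hx1 : x ∈ Y1
    · simpa [c, hx1] using (h1 x hx1).1
    · simpa [c, hx1] using (h0 x (hx.resolve_right hx1)).1
  · rcases hlx : l x with m | m
    · obtain ⟨x', hx', a1, a2, a3⟩ := key1 x hx m hlx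
      obtain ⟨y', hy', b1, b2, b3⟩ := key1 y hy m (e ▸ hlx)
      have := ((h1 x' hx').2 y' hy' (by rw [a1, b1, hc])).1 (by rw [a2, b2])
      rw [dist_comm] at b3
      linarith [dist_triangle x x' y, dist_triangle x' y' y]
    · have hly : l y = Sum.inr m := e ▸ hlx
      have aux : ∀ x ∈ Y0 ∪ Y1, l x = Sum.inr m → x ∉ Y1 ∧ l0 x = m := by
        intro x hx hl
        by_cases hx1 : x ∈ Y1
        · simp [l, hx1] at hl
        · by_cases h : ∃ m, P (c0 x) (l0 x) m
          · simp only [l, if_neg hx1, dif_pos h] at hl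
            exact absurd hl (by simp)
          · simp only [l, if_neg hx1, dif_neg h, Sum.inr.injEq] at hl
            exact ⟨hx1, hl⟩
      obtain ⟨a1, a2⟩ := aux x hx hlx
      obtain ⟨b1, b2⟩ := aux y hy hly
      have := ((h0 x (hx.resolve_right a1)).2 y (hy.resolve_right b1) (by simpa [c, a1, b1] using hc)).1
        (by rw [a2, b2])
      linarith
  · by_cases hx1 : x ∈ Y1 <;> by_cases hy1 : y ∈ Y1
    · have := ((h1 x hx1).2 y hy1 (by simpa [c, hx1, hy1] using hc)).2
        (fun h => e (by simp [l, hx1, hy1, h]))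
      linarith
    · by_contra! hlt
      exact e (key2 x hx1 y (hy.resolve_right hy1) hy1 (by simpa [c, hx1, hy1] using hc) hlt)
    · by_contra! hlt
      exact e (key2 y hy1 x (hx.resolve_right hx1) hx1 (by simpa [c, hx1, hy1] using hc.symm)
        (by rwa [dist_comm])).symm
    · have hc' : c0 x = c0 y := by simpa [c, hx1, hy1] using hc
      refine ((h0 x (hx.resolve_right hx1)).2 y (hy.resolve_right hy1) hc').2 (fun h => e ?_)
      simp only [l, if_neg hx1, if_neg hy1, hc', h]

theorem Cov.functions {X : Type*} [PseudoMetricSpace X] {Y : Set X} {N : X → ℕ} {Λ D : ℝ}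
    (h : Cov dist Y N (2 * Λ) D) (hΛ : 0 < Λ) :
    ∃ v : ℕ × X → X → ℝ, (∀ i x, 0 ≤ v i x) ∧ (∀ i x, v i x ≤ Λ) ∧
      (∀ i x y, v i x ≤ v i y + dist x y) ∧
      (∀ i x y, 0 < v i x → 0 < v i y → dist x y ≤ D + 2 * Λ) ∧
      (∀ x ∈ Y, ∃ i, v i x = Λ) ∧
      (∀ i j x, 0 < v i x → 0 < v j x → i.1 = j.1 → i = j) ∧
      (∀ i x, 0 < v i x → ∃ y ∈ Y, dist x y < Λ ∧ i.1 < N y) := by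
  obtain ⟨c, l, h⟩ := h
  let v : ℕ × X → X → ℝ := fun i x => ⨆ y : {y // y ∈ Y ∧ c y = i.1 ∧ l y = i.2},
    max 0 (Λ - dist x y)
  have v0 : ∀ i x, 0 ≤ v i x := fun i x => Real.iSup_nonneg (fun y => le_max_left _ _)
  have v1 : ∀ i x, v i x ≤ Λ := fun i x =>
    Real.iSup_le (fun y => max_le hΛ.le (by linarith [dist_nonneg (x := x) (y := (y : X))])) hΛ.le
  have vb : ∀ (i : ℕ × X) (x : X), BddAbove (Set.range fun y : {y // y ∈ Y ∧ c y = i.1 ∧ l y = i.2} =>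
      max 0 (Λ - dist x y)) := by
    intro i x
    refine ⟨Λ, ?_⟩
    rintro _ ⟨y, rfl⟩
    exact max_le hΛ.le (by linarith [dist_nonneg (x := x) (y := (y : X))])
  have vpos : ∀ i x, 0 < v i x → ∃ y ∈ Y, c y = i.1 ∧ l y = i.2 ∧ dist x y < Λ := by
    intro i x hp
    by_contra! hcon
    have : v i x ≤ 0 := by
      refine Real.iSup_le (fun y => ?_) le_rfl
      have := hcon y y.2.1 y.2.2.1 y.2.2.2
      exact max_le le_rfl (by linarith)
    linarith
  refine ⟨v, v0, v1, ?_, ?_, ?_, ?_, ?_⟩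
  · intro i x y
    refine Real.iSup_le (fun z => ?_) (add_nonneg (v0 i y) dist_nonneg)
    have h1 : max 0 (Λ - dist y z) ≤ v i y := le_ciSup (vb i y) z
    have h2 := dist_triangle y x z
    rw [dist_comm y x] at h2
    refine max_le (add_nonneg (v0 i y) dist_nonneg) ?_
    linarith [le_max_right 0 (Λ - dist y z)]
  · intro i x y hx hy
    obtain ⟨x', hx', a1, a2, a3⟩ := vpos i x hx
    obtain ⟨y', hy', b1, b2, b3⟩ := vpos i y hy
    have := ((h x' hx').2 y' hy' (by rw [a1, b1])).1 (by rw [a2, b2])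
    rw [dist_comm] at b3
    linarith [dist_triangle x x' y, dist_triangle x' y' y]
  · intro x hx
    refine ⟨(c x, l x), le_antisymm (v1 _ _) ?_⟩
    have h1 := le_ciSup (vb (c x, l x) x) ⟨x, hx, rfl, rfl⟩
    simp only [dist_self, sub_zero] at h1
    exact (le_max_right _ _).trans h1
  · intro i j x hi hj hij
    obtain ⟨x', hx', a1, a2, a3⟩ := vpos i x hi
    obtain ⟨y', hy', b1, b2, b3⟩ := vpos j x hj
    refine Prod.ext hij ?_
    by_contra hne
    have := ((h x' hx').2 y' hy' (by rw [a1, b1, hij])).2 (by rw [a2, b2]; exact hne)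
    rw [dist_comm] at a3
    linarith [dist_triangle x' x y']
  · intro i x hp
    obtain ⟨x', hx', a1, a2, a3⟩ := vpos i x hp
    exact ⟨x', hx', a3, a1 ▸ (h x' hx').1⟩

theorem gap {I : Type*} (f : I → ℝ) (s : Finset I) (N : ℕ) (δ : ℝ) (hδ : 0 < δ)
    (hs : s.card ≤ N) (h0 : ∀ i ∉ s, f i ≤ 0) (i0 : I) (hi0 : δ * N ≤ f i0) (hN : 0 < N) :
    ∃ σ ⊆ s, i0 ∈ σ ∧ (∀ i ∈ σ, δ ≤ f i) ∧ ∀ i ∈ σ, ∀ j ∉ σ, f j + δ ≤ f i := by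
  classical
  have hNpos : (0 : ℝ) < N := by exact_mod_cast hN
  have hi0s : i0 ∈ s := by
    by_contra h
    have := h0 i0 h
    have := mul_pos hδ hNpos
    linarith
  have hk : ∃ k < N, ∀ i ∈ s, ¬ (δ * k < f i ∧ f i < δ * (k + 1)) := by
    by_contra! hcon
    haveI : Nonempty I := ⟨i0⟩
    choose! g hg using hcon
    have hinj : ∀ a ∈ Finset.range N, ∀ b ∈ Finset.range N, g a = g b → a = b := by
      intro a ha b hb hab
      have h1 := (hg a (Finset.mem_range.1 ha)).2
      have h2 := (hg b (Finset.mem_range.1 hb)).2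
      rw [hab] at h1
      have e1 : (a : ℝ) < b + 1 := by
        by_contra! h
        have := mul_le_mul_of_nonneg_left h hδ.le
        linarith
      have e2 : (b : ℝ) < a + 1 := by
        by_contra! h
        have := mul_le_mul_of_nonneg_left h hδ.le
        linarith
      have e1' : a < b + 1 := by exact_mod_cast e1
      have e2' : b < a + 1 := by exact_mod_cast e2
      omega
    have hmaps : ∀ a ∈ Finset.range N, g a ∈ s.erase i0 := by
      intro a ha
      have ha' := Finset.mem_range.1 ha
      refine Finset.mem_erase.2 ⟨?_, (hg a ha').1⟩
      intro e
      have h1 := (hg a ha').2.2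
      rw [e] at h1
      have : (a : ℝ) + 1 ≤ N := by exact_mod_cast ha'
      have := mul_le_mul_of_nonneg_left this hδ.le
      linarith
    have := Finset.card_le_card_of_injOn g hmaps (fun a ha b hb => hinj a ha b hb)
    rw [Finset.card_range, Finset.card_erase_of_mem hi0s] at this
    omega
  obtain ⟨k, hkN, hk⟩ := hk
  have hk1 : δ * (k + 1 : ℝ) ≤ δ * N := by
    refine mul_le_mul_of_nonneg_left ?_ hδ.le
    exact_mod_cast hkN
  have hk0 : 0 ≤ δ * (k : ℝ) := by positivity
  refine ⟨s.filter (fun i => δ * (k + 1 : ℝ) ≤ f i), Finset.filter_subset _ _, ?_, ?_, ?_⟩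
  · simp only [Finset.mem_filter]; exact ⟨hi0s, hk1.trans hi0⟩
  · intro i hi
    have := (Finset.mem_filter.1 hi).2
    linarith
  · intro i hi j hj
    have hi' := (Finset.mem_filter.1 hi).2
    by_cases hjs : j ∈ s
    · have h1 : ¬ δ * (k + 1 : ℝ) ≤ f j := fun h => hj (Finset.mem_filter.2 ⟨hjs, h⟩)
      have h2 := hk j hjs
      have h3 : f j ≤ δ * k := by
        by_contra! h
        exact h2 ⟨h, not_le.1 h1⟩
      linarith
    · have := h0 j hjs
      linarith

theorem cov_of_functions {X I : Type*} [PseudoMetricSpace X] (f : I → X → ℝ) (N : ℕ) (hN : 0 < N)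
    (δ D : ℝ) (hδ : 0 < δ) (hlip : ∀ i x y, f i x ≤ f i y + 2 * dist x y)
    (hbd : ∀ i x y, 0 < f i x → 0 < f i y → dist x y ≤ D)
    (hmult : ∀ x, ∃ s : Finset I, s.card ≤ N ∧ ∀ i ∉ s, f i x ≤ 0)
    (hbig : ∀ x, ∃ i, δ * N ≤ f i x) :
    Cov dist (Set.univ : Set X) (fun _ => N) (δ / 2) D := by
  classical
  have H : ∀ x, ∃ σ : Finset I, σ.card ≤ N ∧ σ.Nonempty ∧ (∀ i ∈ σ, δ ≤ f i x) ∧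
      ∀ i ∈ σ, ∀ j ∉ σ, f j x + δ ≤ f i x := by
    intro x
    obtain ⟨s, hs, h0⟩ := hmult x
    obtain ⟨i0, hi0⟩ := hbig x
    obtain ⟨σ, h1, h2, h3, h4⟩ := gap (fun i => f i x) s N δ hδ hs h0 i0 hi0 hN
    exact ⟨σ, (Finset.card_le_card h1).trans hs, ⟨i0, h2⟩, h3, h4⟩
  choose σ h1 h2 h3 h4 using H
  refine Cov.of_labels (fun x => (σ x).card - 1) σ (fun x _ => ⟨?_, fun y _ hc => ⟨fun e => ?_, fun e => ?_⟩⟩)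
  · have := h1 x; have := (h2 x).card_pos; omega
  · obtain ⟨i, hi⟩ := h2 x
    exact hbd i x y (hδ.trans_le (h3 x i hi)) (hδ.trans_le (h3 y i (e ▸ hi)))
  · have hcard : (σ x).card = (σ y).card := by
      have := (h2 x).card_pos; have := (h2 y).card_pos; omega
    have ha : ¬ σ x ⊆ σ y := fun h => e (Finset.eq_of_subset_of_card_le h hcard.ge)
    have hb : ¬ σ y ⊆ σ x := fun h => e (Finset.eq_of_subset_of_card_le h hcard.le).symm
    obtain ⟨i, hi, hi'⟩ := Finset.not_subset.1 ha
    obtain ⟨j, hj, hj'⟩ := Finset.not_subset.1 hb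
    have e1 := h4 x i hi j hj'
    have e2 := h4 y j hj i hi'
    have e3 := hlip i x y
    have e4 := hlip j y x
    rw [dist_comm y x] at e4
    linarith

end AmalgAsdim
namespace AmalgAsdim

theorem finset_of_colors {X : Type*} (P : ℕ × X → Prop) (m : ℕ)
    (h1 : ∀ i j, P i → P j → i.1 = j.1 → i = j) (h2 : ∀ i, P i → i.1 < m) :
    ∃ s : Finset (ℕ × X), s.card ≤ m ∧ ∀ i, i ∈ s ↔ P i := by
  classical
  have hinj : Set.InjOn Prod.fst {i | P i} := fun i hi j hj h => h1 i j hi hj h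
  have hmaps : Set.MapsTo Prod.fst {i | P i} (Finset.range m : Set ℕ) := fun i hi => by
    simpa using h2 i hi
  have hfin : {i | P i}.Finite := Set.Finite.of_injOn hmaps hinj (Finset.finite_toSet _)
  refine ⟨hfin.toFinset, ?_, fun i => by simp⟩
  have := Finset.card_le_card_of_injOn (s := hfin.toFinset) (t := Finset.range m) Prod.fst
    (fun i hi => by simpa using h2 i (by simpa using hi))
    (fun i hi j hj h => h1 i j (by simpa using hi) (by simpa using hj) h)
  simpa using this

theorem count {I : Type*} (v : I → ℝ) (T : ℝ) (s : Finset I) (m : ℕ)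
    (hs : ∀ i ∉ s, v i ≤ 0) (hm : s.card ≤ m) (hT : 0 ≤ T) (G : Finset I → Prop)
    (hG1 : ∀ σ, G σ → σ.Nonempty) (hG2 : ∀ σ, G σ → ∀ i ∈ σ, 0 < v i)
    (hG3 : ∀ σ, G σ → ∀ i ∈ σ, ∀ j ∉ σ, v j < min (v i) T) :
    ∃ (S : Finset (Finset I)) (A : Finset I), (∀ σ, G σ → σ ∈ S) ∧ (∀ i, T < v i → i ∈ A) ∧
      (∀ i ∈ A, T < v i) ∧ (A = ∅ → S.card ≤ m) ∧ S.card + A.card ≤ m + 1 := by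
  classical
  let A := s.filter (fun i => T < v i)
  let S := s.powerset.filter G
  have hsub : ∀ σ, G σ → σ ⊆ s := by
    intro σ hσ i hi
    by_contra h
    linarith [hs i h, hG2 σ hσ i hi]
  have hA : ∀ σ, G σ → A ⊆ σ := by
    intro σ hσ i hi
    by_contra h
    obtain ⟨k, hk⟩ := hG1 σ hσ
    have := hG3 σ hσ k hk i h
    have h2 := (Finset.mem_filter.1 hi).2
    linarith [min_le_right (v k) T]
  have hcard : S.card ≤ (Finset.Icc (max 1 A.card) m).card := by
    refine Finset.card_le_card_of_injOn Finset.card ?_ ?_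
    · intro σ hσ
      have hσ' := (Finset.mem_filter.1 hσ).2
      have h1 := (hG1 σ hσ').card_pos
      have h2 := Finset.card_le_card (hA σ hσ')
      have h3 := Finset.card_le_card (hsub σ hσ')
      simp only [Finset.coe_Icc, Set.mem_Icc]
      omega
    · intro σ hσ τ hτ hc
      have hσ' := (Finset.mem_filter.1 hσ).2
      have hτ' := (Finset.mem_filter.1 hτ).2
      by_contra e
      have ha : ¬ σ ⊆ τ := fun h => e (Finset.eq_of_subset_of_card_le h hc.ge)
      have hb : ¬ τ ⊆ σ := fun h => e (Finset.eq_of_subset_of_card_le h hc.le).symm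
      obtain ⟨i, hi, hi'⟩ := Finset.not_subset.1 ha
      obtain ⟨j, hj, hj'⟩ := Finset.not_subset.1 hb
      have e1 := hG3 σ hσ' i hi j hj'
      have e2 := hG3 τ hτ' j hj i hi'
      linarith [min_le_left (v i) T, min_le_left (v j) T]
  rw [Nat.card_Icc] at hcard
  have hAm : A.card ≤ m := (Finset.card_le_card (Finset.filter_subset _ _)).trans hm
  refine ⟨S, A, ?_, ?_, ?_, ?_, ?_⟩
  · intro σ hσ
    exact Finset.mem_filter.2 ⟨Finset.mem_powerset.2 (hsub σ hσ), hσ⟩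
  · intro i hi
    refine Finset.mem_filter.2 ⟨?_, hi⟩
    by_contra h
    linarith [hs i h]
  · intro i hi
    exact (Finset.mem_filter.1 hi).2
  · intro _
    omega
  · omega

/-- The barycentric functions. -/
noncomputable def bary {I X : Type*} (v : I → X → ℝ) (T : X → ℝ) (σ : Finset I) (x : X) : ℝ :=
  ⨅ p : {i // i ∈ σ} × Option {j // j ∉ σ},
    max 0 (min (v p.1 x) (T x) - p.2.elim 0 (fun j => v j x))

theorem bary_bdd {I X : Type*} (v : I → X → ℝ) (T : X → ℝ) (σ : Finset I) (x : X) :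
    BddBelow (Set.range fun p : {i // i ∈ σ} × Option {j // j ∉ σ} =>
      max 0 (min (v p.1 x) (T x) - p.2.elim 0 (fun j => v j x))) :=
  ⟨0, by rintro _ ⟨p, rfl⟩; exact le_max_left _ _⟩

theorem bary_nonneg {I X : Type*} (v : I → X → ℝ) (T : X → ℝ) (σ : Finset I) (x : X) :
    0 ≤ bary v T σ x := Real.iInf_nonneg (fun _ => le_max_left _ _)

theorem bary_pos {I X : Type*} (v : I → X → ℝ) (T : X → ℝ) (σ : Finset I) (x : X)
    (h : 0 < bary v T σ x) : σ.Nonempty ∧ (∀ i ∈ σ, 0 < min (v i x) (T x)) ∧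
      ∀ i ∈ σ, ∀ j ∉ σ, v j x < min (v i x) (T x) := by
  refine ⟨?_, ?_, ?_⟩
  · by_contra hne
    rw [Finset.not_nonempty_iff_eq_empty] at hne
    subst hne
    have : IsEmpty ({i : I // i ∈ (∅ : Finset I)} × Option {j : I // j ∉ (∅ : Finset I)}) :=
      ⟨fun p => Finset.notMem_empty _ p.1.2⟩
    rw [bary, Real.iInf_of_isEmpty] at h
    exact lt_irrefl _ h
  · intro i hi
    have := h.trans_le (ciInf_le (bary_bdd v T σ x) (⟨i, hi⟩, none))
    simpa using this
  · intro i hi j hj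
    have := h.trans_le (ciInf_le (bary_bdd v T σ x) (⟨i, hi⟩, some ⟨j, hj⟩))
    rcases lt_max_iff.1 this with h | h
    · exact absurd h (lt_irrefl _)
    · simp only [Option.elim] at h
      linarith

theorem le_bary {I X : Type*} (v : I → X → ℝ) (T : X → ℝ) (σ : Finset I) (x : X) (δ : ℝ)
    (hne : σ.Nonempty) (h1 : ∀ i ∈ σ, δ ≤ min (v i x) (T x))
    (h2 : ∀ i ∈ σ, ∀ j ∉ σ, v j x + δ ≤ min (v i x) (T x)) : δ ≤ bary v T σ x := by
  obtain ⟨i, hi⟩ := hne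
  have : Nonempty ({i : I // i ∈ σ} × Option {j : I // j ∉ σ}) := ⟨(⟨i, hi⟩, none)⟩
  refine le_ciInf ?_
  rintro ⟨⟨i, hi⟩, _ | ⟨j, hj⟩⟩
  · refine le_max_of_le_right ?_
    simpa using h1 i hi
  · refine le_max_of_le_right ?_
    have := h2 i hi j hj
    simp only [Option.elim]
    linarith

theorem bary_lip {I X : Type*} [PseudoMetricSpace X] (v : I → X → ℝ) (T : X → ℝ)
    (hv : ∀ i x y, v i x ≤ v i y + dist x y) (hT : ∀ x y, T x ≤ T y + dist x y)
    (σ : Finset I) (x y : X) : bary v T σ x ≤ bary v T σ y + 2 * dist x y := by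
  have hd : 0 ≤ dist x y := dist_nonneg
  by_cases hne : σ.Nonempty
  · obtain ⟨i, hi⟩ := hne
    have : Nonempty ({i : I // i ∈ σ} × Option {j : I // j ∉ σ}) := ⟨(⟨i, hi⟩, none)⟩
    rw [← sub_le_iff_le_add]
    refine le_ciInf ?_
    intro p
    have h1 := ciInf_le (bary_bdd v T σ x) p
    change bary v T σ x ≤ _ at h1
    rw [sub_le_iff_le_add]
    refine h1.trans (max_le ?_ ?_)
    · have := le_max_left 0 (min (v p.1 y) (T y) - p.2.elim 0 (fun j => v j y))
      linarith
    · have h2 := le_max_right 0 (min (v p.1 y) (T y) - p.2.elim 0 (fun j => v j y))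
      have h3 : min (v p.1 x) (T x) ≤ min (v p.1 y) (T y) + dist x y := by
        rw [← min_add_add_right]
        exact min_le_min (hv _ _ _) (hT _ _)
      have h4 : p.2.elim 0 (fun j => v j y) ≤ p.2.elim 0 (fun j => v j x) + dist x y := by
        rcases p.2 with _ | j
        · simpa using hd
        · have := hv j y x
          rw [dist_comm] at this
          simpa using this
      linarith
  · have : bary v T σ x ≤ 0 := by
      by_contra! h
      exact hne (bary_pos v T σ x h).1
    linarith [bary_nonneg v T σ y]

/-- The pushed forward functions. -/
noncomputable def push {I J X : Type*} (v : I → X → ℝ) (T : X → ℝ) (φ : I → J) (j : J) (x : X) :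
    ℝ := ⨆ i : {i // φ i = j}, max 0 (v i x - T x)

theorem push_nonneg {I J X : Type*} (v : I → X → ℝ) (T : X → ℝ) (φ : I → J) (j : J) (x : X) :
    0 ≤ push v T φ j x := Real.iSup_nonneg (fun _ => le_max_left _ _)

theorem push_le {I J X : Type*} (v : I → X → ℝ) (T : X → ℝ) (φ : I → J) (j : J) (x : X) (a : ℝ)
    (ha : 0 ≤ a) (h : ∀ i, φ i = j → v i x - T x ≤ a) : push v T φ j x ≤ a :=
  Real.iSup_le (fun i => max_le ha (h i i.2)) ha

theorem push_pos {I J X : Type*} (v : I → X → ℝ) (T : X → ℝ) (φ : I → J) (j : J) (x : X)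
    (h : 0 < push v T φ j x) : ∃ i, φ i = j ∧ T x < v i x := by
  by_contra! hcon
  have := push_le v T φ j x 0 le_rfl (fun i hi => by linarith [hcon i hi])
  linarith

theorem le_push {I J X : Type*} (v : I → X → ℝ) (T : X → ℝ) (φ : I → J) (x : X) (Λ : ℝ)
    (hv : ∀ i, v i x ≤ Λ) (i : I) : v i x - T x ≤ push v T φ (φ i) x := by
  refine (le_max_right 0 _).trans (le_ciSup (f := fun k : {k // φ k = φ i} => max 0 (v k x - T x)) ?_ ⟨i, rfl⟩)
  refine ⟨max 0 (Λ - T x), ?_⟩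
  rintro _ ⟨k, rfl⟩
  exact max_le_max le_rfl (by linarith [hv k])

theorem push_lip {I J X : Type*} [PseudoMetricSpace X] (v : I → X → ℝ) (T : X → ℝ) (Λ : ℝ)
    (hvΛ : ∀ i x, v i x ≤ Λ)
    (hv : ∀ i x y, v i x ≤ v i y + dist x y) (hT : ∀ x y, T x ≤ T y + dist x y)
    (φ : I → J) (j : J) (x y : X) : push v T φ j x ≤ push v T φ j y + 2 * dist x y := by
  have hd : 0 ≤ dist x y := dist_nonneg
  refine push_le v T φ j x _ (add_nonneg (push_nonneg v T φ j y) (by positivity)) ?_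
  rintro i rfl
  have h1 := le_push v T φ y Λ (fun i => hvΛ i y) i
  have h2 := hv i x y
  have h3 := hT y x
  rw [dist_comm] at h3
  linarith

theorem gluing {X E ι : Type*} [PseudoMetricSpace X] (n : ℕ) (Λ : ℝ) (hΛ : 0 < Λ)
    (θ : X → ℝ) (e : X → E) (w : X → ι)
    (hθ0 : ∀ x, 0 ≤ θ x) (hθ : ∀ x y, θ x ≤ θ y + dist x y)
    (he : ∀ x y, e x ≠ e y → θ x ≤ dist x y)
    (he2 : ∀ x y, e x ≠ e y → 0 < θ x → 0 < θ y → 2 * Λ ≤ dist x y)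
    (hw : ∀ x y, w x ≠ w y → θ x ≤ 3 * Λ → θ y ≤ 3 * Λ → 2 * Λ ≤ dist x y)
    (h4 : ∀ r, 0 < r → ∃ D, ∀ i, Cov dist {x | θ x = 0 ∧ w x = i} (fun _ => n + 1) r D)
    (h5 : ∀ r, 0 < r → ∃ D, ∀ i, Cov dist {x | 0 < θ x ∧ e x = i} (fun _ => n) r D) :
    ∃ D, Cov dist (Set.univ : Set X) (fun _ => n + 1) (Λ / (2 * (n + 1)) / (n + 1) / 2) D := by
  classical
  let Nf : X → ℕ := fun x => if 0 < θ x then n else n + 1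
  obtain ⟨D0', hD0'⟩ := h5 (2 * Λ) (by positivity)
  obtain ⟨D0, hD0, hD0nn⟩ : ∃ D0, (∀ i, Cov dist {x | 0 < θ x ∧ e x = i} (fun _ => n) (2 * Λ) D0) ∧
      0 ≤ D0 := ⟨max D0' 0, fun i => (hD0' i).mono subset_rfl (fun _ _ => le_rfl) le_rfl
        (le_max_left _ _), le_max_right _ _⟩
  obtain ⟨D1', hD1'⟩ := h4 (D0 + 2 * (2 * Λ) + 1) (by positivity)
  obtain ⟨D1, hD1, hD1nn⟩ : ∃ D1, (∀ i, Cov dist {x | θ x = 0 ∧ w x = i} (fun _ => n + 1)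
      (D0 + 2 * (2 * Λ) + 1) D1) ∧
      0 ≤ D1 := ⟨max D1' 0, fun i => (hD1' i).mono subset_rfl (fun _ _ => le_rfl) le_rfl
        (le_max_left _ _), le_max_right _ _⟩
  have hwall : Cov dist {x | 0 < θ x} Nf (2 * Λ) D0 := by
    refine Cov.disjUnion e (fun i => ?_) (fun x hx y hy hxy => he2 x y hxy hx hy)
    refine (hD0 i).mono subset_rfl ?_ le_rfl le_rfl
    intro x hx
    have hx1 : 0 < θ x := hx.1
    simp [Nf, hx1]
  obtain ⟨DV, hDV, hV⟩ : ∃ DV, 0 ≤ DV ∧ Cov dist {x | θ x ≤ 3 * Λ} Nf (2 * Λ) DV := by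
    refine ⟨D1 + 2 * (D0 + 2 * Λ), by positivity, ?_⟩
    refine Cov.disjUnion w (fun i => ?_) (fun x hx y hy hxy => hw x y hxy hx hy)
    have h0 : Cov dist {x | θ x = 0 ∧ w x = i} Nf (D0 + 2 * (2 * Λ) + 1) D1 := by
      refine (hD1 i).mono subset_rfl ?_ le_rfl le_rfl
      intro x hx
      simp only [Nf, hx.1, lt_irrefl, if_false]; exact le_rfl
    have h1 : Cov dist {x | 0 < θ x ∧ w x = i} Nf (2 * Λ) D0 :=
      hwall.mono (fun x hx => hx.1) (fun _ _ => le_rfl) le_rfl le_rfl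
    refine (Cov.union h1 h0 (by positivity) hD0nn hD1nn (by linarith)).mono ?_ (fun _ _ => le_rfl)
      le_rfl le_rfl
    rintro x ⟨_, hx⟩
    rcases (hθ0 x).eq_or_lt with h | h
    · exact Or.inr ⟨h.symm, hx⟩
    · exact Or.inl ⟨h, hx⟩
  obtain ⟨v, v0, vΛ, vlip, vbd, vcov, vinj, vpal⟩ := hV.functions hΛ
  obtain ⟨Λu, hΛu⟩ : ∃ Λu, Λu = DV + 2 * Λ + 1 := ⟨_, rfl⟩
  have hΛu0 : 0 < Λu := by rw [hΛu]; positivity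
  obtain ⟨Du, hDu⟩ := h5 (2 * Λu) (by positivity)
  have hu := fun i => (hDu i).functions hΛu0
  choose u u0 uΛ ulip ubd ucov uinj upal using hu
  let T : X → ℝ := fun x => max 0 (min Λ (2 * Λ - θ x))
  have hT0 : ∀ x, 0 ≤ T x := fun x => le_max_left _ _
  have hTlip : ∀ x y, T x ≤ T y + dist x y := by
    intro x y
    have hd : 0 ≤ dist x y := dist_nonneg
    have h1 := hθ y x
    rw [dist_comm] at h1
    have a1 := le_max_left 0 (min Λ (2 * Λ - θ y))
    have a2 : min Λ (2 * Λ - θ y) ≤ T y := le_max_right 0 (min Λ (2 * Λ - θ y))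
    refine max_le (add_nonneg a1 hd) ?_
    rcases min_cases Λ (2 * Λ - θ y) with ⟨h, _⟩ | ⟨h, _⟩
    · rw [h] at a2
      have := min_le_left Λ (2 * Λ - θ x)
      have : Λ ≤ T y := a2
      linarith
    · rw [h] at a2
      have := min_le_right Λ (2 * Λ - θ x)
      have : 2 * Λ - θ y ≤ T y := a2
      linarith
  have hTbig : ∀ x, θ x ≤ Λ → T x = Λ := by
    intro x hx
    simp only [T]
    rw [min_eq_left (by linarith), max_eq_right hΛ.le]
  have hTzero : ∀ x, 2 * Λ ≤ θ x → T x = 0 := by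
    intro x hx
    simp only [T]
    rw [min_eq_right (by linarith), max_eq_left (by linarith)]
  have hTθ : ∀ x, Λ ≤ T x + θ x := by
    intro x
    by_cases h : θ x ≤ Λ
    · rw [hTbig x h]; linarith [hθ0 x]
    · linarith [hT0 x]
  have hφ : ∀ (k : E) (i : ℕ × X), ∃ j : ℕ × X, ∀ x, e x = k → 0 < θ x → 0 < v i x →
      0 < u k j x := by
    intro k i
    by_cases hex : ∃ x0, e x0 = k ∧ 0 < θ x0 ∧ 0 < v i x0
    · obtain ⟨x0, hx1, hx2, hx3⟩ := hex
      obtain ⟨j, hj⟩ := ucov k x0 ⟨hx2, hx1⟩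
      refine ⟨j, fun x _ _ hx => ?_⟩
      have h1 := vbd i x0 x hx3 hx
      have h2 := ulip k j x0 x
      linarith
    · push Not at hex
      exact ⟨i, fun x h1 h2 h3 => absurd h3 (not_lt.2 (hex x h1 h2))⟩
  choose φ hφ using hφ
  let cl : X → ℝ := fun x => max 0 (min Λ (θ x - 2 * Λ))
  have hcl0 : ∀ x, 0 ≤ cl x := fun x => le_max_left _ _
  have hclθ : ∀ x, cl x ≤ θ x := fun x => max_le (hθ0 x) ((min_le_right _ _).trans (by linarith))
  have hcllip : ∀ x y, cl x ≤ cl y + dist x y := by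
    intro x y
    have hd : 0 ≤ dist x y := dist_nonneg
    have h1 := hθ x y
    have a1 := le_max_left 0 (min Λ (θ y - 2 * Λ))
    have a2 : min Λ (θ y - 2 * Λ) ≤ cl y := le_max_right 0 (min Λ (θ y - 2 * Λ))
    refine max_le (add_nonneg a1 hd) ?_
    rcases min_cases Λ (θ y - 2 * Λ) with ⟨h, _⟩ | ⟨h, _⟩
    · rw [h] at a2
      have := min_le_left Λ (θ x - 2 * Λ)
      have : Λ ≤ cl y := a2
      linarith
    · rw [h] at a2
      have := min_le_right Λ (θ x - 2 * Λ)
      have : θ y - 2 * Λ ≤ cl y := a2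
      linarith
  have hclsmall : ∀ x, θ x ≤ 2 * Λ → cl x = 0 := by
    intro x hx
    simp only [cl]
    rw [min_eq_right (by linarith), max_eq_left (by linarith)]
  have hclbig : ∀ x, 3 * Λ ≤ θ x → cl x = Λ := by
    intro x hx
    simp only [cl]
    rw [min_eq_left (by linarith), max_eq_right hΛ.le]
  let F : E × (ℕ × X) → X → ℝ := fun p x => if e x = p.1 then
    max (push v T (φ p.1) p.2 x) (min (u p.1 p.2 x) (cl x)) else 0
  have hF0 : ∀ p x, 0 ≤ F p x := by
    intro p x
    simp only [F]
    split_ifs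
    · exact (push_nonneg _ _ _ _ _).trans (le_max_left _ _)
    · exact le_rfl
  have hFθ : ∀ p x, F p x ≤ θ x := by
    intro p x
    simp only [F]
    split_ifs
    · refine max_le (push_le _ _ _ _ _ _ (hθ0 x) (fun i _ => ?_)) ((min_le_right _ _).trans (hclθ x))
      linarith [vΛ i x, hTθ x]
    · exact hθ0 x
  have hFpos : ∀ p x, 0 < F p x → e x = p.1 ∧ 0 < u p.1 p.2 x ∧
      ((∃ i, φ p.1 i = p.2 ∧ T x < v i x) ∨ 0 < cl x) := by
    intro p x hp
    have hθp : 0 < θ x := hp.trans_le (hFθ p x)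
    simp only [F] at hp
    split_ifs at hp with hex
    · refine ⟨hex, ?_⟩
      rcases lt_max_iff.1 hp with h | h
      · obtain ⟨i, hi, hi2⟩ := push_pos _ _ _ _ _ h
        refine ⟨?_, Or.inl ⟨i, hi, hi2⟩⟩
        rw [← hi]
        exact hφ p.1 i x hex hθp ((hT0 x).trans_lt hi2)
      · exact ⟨(lt_min_iff.1 h).1, Or.inr (lt_min_iff.1 h).2⟩
    · exact absurd hp (lt_irrefl _)
  have hFlip : ∀ p x y, F p x ≤ F p y + 2 * dist x y := by
    intro p x y
    have hd : 0 ≤ dist x y := dist_nonneg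
    by_cases hx : e x = p.1
    · by_cases hy : e y = p.1
      · simp only [F, if_pos hx, if_pos hy]
        refine max_le ?_ ?_
        · have := push_lip v T Λ vΛ vlip hTlip (φ p.1) p.2 x y
          linarith [le_max_left (push v T (φ p.1) p.2 y) (min (u p.1 p.2 y) (cl y))]
        · have h1 : min (u p.1 p.2 x) (cl x) ≤ min (u p.1 p.2 y) (cl y) + dist x y := by
            rw [← min_add_add_right]
            exact min_le_min (ulip _ _ _ _) (hcllip _ _)
          linarith [le_max_right (push v T (φ p.1) p.2 y) (min (u p.1 p.2 y) (cl y))]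
      · have h1 := he x y (by rw [hx]; exact fun h => hy h.symm)
        linarith [hFθ p x, hF0 p y]
    · have : F p x = 0 := by simp [F, hx]
      linarith [hF0 p y]
  let f : Finset (ℕ × X) ⊕ (E × (ℕ × X)) → X → ℝ := Sum.elim (bary v T) F
  refine ⟨max (DV + 2 * Λ) (Du + 2 * Λu), ?_⟩
  have := cov_of_functions f (n + 1) (Nat.succ_pos n) (Λ / (2 * (n + 1)) / (n + 1))
    (max (DV + 2 * Λ) (Du + 2 * Λu)) (by positivity) ?_ ?_ ?_ ?_
  · exact this
  · rintro (σ | p) x y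
    · exact bary_lip v T vlip hTlip σ x y
    · exact hFlip p x y
  · rintro (σ | p) x y hx hy
    · obtain ⟨⟨i, hi⟩, h1, _⟩ := bary_pos v T σ x hx
      obtain ⟨_, h2, _⟩ := bary_pos v T σ y hy
      exact (vbd i x y (lt_min_iff.1 (h1 i hi)).1 (lt_min_iff.1 (h2 i hi)).1).trans (le_max_left _ _)
    · exact (ubd _ _ x y (hFpos p x hx).2.1 (hFpos p y hy).2.1).trans (le_max_right _ _)
  · intro x
    by_cases hx : 2 * Λ ≤ θ x
    · obtain ⟨s, hs, hs2⟩ := finset_of_colors (fun j => 0 < u (e x) j x) n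
        (fun i j hi hj h => uinj _ i j x hi hj h)
        (fun i hi => by obtain ⟨y, _, _, h⟩ := upal _ i x hi; exact h)
      refine ⟨s.image (fun j => Sum.inr (e x, j)), (Finset.card_image_le.trans hs).trans (Nat.le_succ n), ?_⟩
      rintro (σ | p) hp
      · by_contra! h
        obtain ⟨⟨i, hi⟩, h1, _⟩ := bary_pos v T σ x h
        have := (lt_min_iff.1 (h1 i hi)).2
        rw [hTzero x hx] at this
        exact lt_irrefl _ this
      · by_contra! h
        obtain ⟨h1, h2, _⟩ := hFpos p x h
        apply hp
        refine Finset.mem_image.2 ⟨p.2, (hs2 _).2 (by rw [h1]; exact h2), ?_⟩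
        rw [h1]
    · push Not at hx
      obtain ⟨m, hm⟩ : ∃ m, m = if Λ < θ x then n else n + 1 := ⟨_, rfl⟩
      obtain ⟨s, hs, hs2⟩ := finset_of_colors (fun i => 0 < v i x) m
        (fun i j hi hj h => vinj i j x hi hj h)
        (fun i hi => by
          obtain ⟨y, _, hd, h⟩ := vpal i x hi
          by_cases hxΛ : Λ < θ x
          · have : 0 < θ y := by linarith [hθ x y]
            simpa [Nf, hm, hxΛ, this] using h
          · rw [hm, if_neg hxΛ]
            refine h.trans_le ?_
            simp only [Nf]
            split_ifs <;> omega)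
      obtain ⟨S, A, hS, hA, hA', hc1, hc2⟩ := count (fun i => v i x) (T x) s m
        (fun i hi => not_lt.1 (fun h => hi ((hs2 i).2 h))) hs (hT0 x)
        (fun σ => 0 < bary v T σ x) (fun σ h => (bary_pos v T σ x h).1)
        (fun σ h i hi => (lt_min_iff.1 ((bary_pos v T σ x h).2.1 i hi)).1)
        (fun σ h => (bary_pos v T σ x h).2.2)
      refine ⟨S.image Sum.inl ∪ A.image (fun i => Sum.inr (e x, φ (e x) i)), ?_, ?_⟩
      · refine (Finset.card_union_le _ _).trans ((Nat.add_le_add Finset.card_image_le Finset.card_image_le).trans ?_)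
        by_cases hxΛ : Λ < θ x
        · rw [if_pos hxΛ] at hm; omega
        · rw [if_neg hxΛ] at hm
          have hAe : A = ∅ := by
            rw [Finset.eq_empty_iff_forall_notMem]
            intro i hi
            have h1 := hA' i hi
            rw [hTbig x (not_lt.1 hxΛ)] at h1
            linarith [vΛ i x]
          have := hc1 hAe
          rw [hAe, Finset.card_empty]
          omega
      · rintro (σ | p) hp
        · by_contra! h
          exact hp (Finset.mem_union_left _ (Finset.mem_image.2 ⟨σ, hS σ h, rfl⟩))
        · by_contra! h
          obtain ⟨h1, h2, h3⟩ := hFpos p x h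
          rw [hclsmall x hx.le] at h3
          rcases h3 with ⟨i, hi, hi2⟩ | h3
          · refine hp (Finset.mem_union_right _ (Finset.mem_image.2 ⟨i, hA i hi2, ?_⟩))
            rw [h1, hi]
          · exact lt_irrefl _ h3
  · intro x
    have hδ : Λ / (2 * (n + 1)) * ((n + 1 : ℕ) : ℝ) = Λ / 2 := by
      push_cast
      field_simp
    have hδ2 : Λ / (2 * (n + 1)) / (n + 1) * ((n + 1 : ℕ) : ℝ) = Λ / (2 * (n + 1)) := by
      push_cast
      field_simp
    have hδ3 : Λ / (2 * (n + 1)) ≤ Λ / 2 := by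
      refine div_le_div_of_nonneg_left hΛ.le (by norm_num) ?_
      have : (0 : ℝ) ≤ n := Nat.cast_nonneg n
      linarith
    rw [hδ2]
    by_cases hx : 3 * Λ ≤ θ x
    · obtain ⟨j, hj⟩ := ucov (e x) x ⟨by linarith, rfl⟩
      refine ⟨Sum.inr (e x, j), ?_⟩
      simp only [f, Sum.elim_inr, F, if_true]
      refine le_max_of_le_right (le_min ?_ ?_)
      · rw [hj]; linarith
      · rw [hclbig x hx]; linarith
    · push Not at hx
      obtain ⟨i, hi⟩ := vcov x hx.le
      by_cases hT : T x < Λ / 2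
      · refine ⟨Sum.inr (e x, φ (e x) i), ?_⟩
        simp only [f, Sum.elim_inr, F, if_true]
        refine le_max_of_le_left ?_
        have := le_push v T (φ (e x)) x Λ (fun i => vΛ i x) i
        linarith
      · push Not at hT
        obtain ⟨s, hs, hs2⟩ := finset_of_colors (fun i => 0 < v i x) (n + 1)
          (fun i j hi hj h => vinj i j x hi hj h)
          (fun i hi => by
            obtain ⟨y, _, hd, h⟩ := vpal i x hi
            refine h.trans_le ?_
            simp only [Nf]
            split_ifs <;> omega)
        obtain ⟨σ, hσ1, hσ2, hσ3, hσ4⟩ := gap (fun i => min (v i x) (T x)) s (n + 1)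
          (Λ / (2 * (n + 1))) (by positivity) hs
          (fun i hi => (min_le_left _ _).trans (not_lt.1 (fun h => hi ((hs2 i).2 h)))) i
          (by rw [hδ]; refine le_min ?_ hT; rw [hi]; linarith) (Nat.succ_pos n)
        refine ⟨Sum.inl σ, le_bary v T σ x _ ⟨i, hσ2⟩ hσ3 ?_⟩
        intro k hk j hj
        have h1 := hσ4 k hk j hj
        have hpos : 0 < Λ / (2 * (n + 1)) := by positivity
        rcases min_cases (v j x) (T x) with ⟨h, _⟩ | ⟨h, _⟩
        · rwa [h] at h1
        · rw [h] at h1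
          linarith [min_le_right (v k x) (T x)]

end AmalgAsdim
namespace AmalgAsdim

/-- The last `k` entries of a list. -/
def anc {W : Type*} (k : ℕ) (l : List W) : List W := l.drop (l.length - k)

theorem anc_cons {W : Type*} (k : ℕ) (a : W) (l : List W) (h : k ≤ l.length) :
    anc k (a :: l) = anc k l := by
  unfold anc
  rw [List.length_cons, Nat.succ_sub h, List.drop_succ_cons]

theorem anc_length {W : Type*} (k : ℕ) (l : List W) (h : k ≤ l.length) :
    (anc k l).length = k := by
  unfold anc
  rw [List.length_drop]; omega

theorem anc_self {W : Type*} (l : List W) : anc l.length l = l := by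
  simp [anc]

theorem anc_append {W : Type*} (k : ℕ) (l : List W) : ∃ ρ, l = ρ ++ anc k l ∧ ρ.length = l.length - k := by
  refine ⟨l.take (l.length - k), (List.take_append_drop _ _).symm, ?_⟩
  rw [List.length_take]; omega

/-- Two lists obtained from a common list by adding at most one entry in front. -/
def Near {W : Type*} (l l' : List W) : Prop :=
  ∃ τ, (l = τ ∨ ∃ a, l = a :: τ) ∧ (l' = τ ∨ ∃ a, l' = a :: τ)

theorem near_anc {W : Type*} {τ l : List W} (h : l = τ ∨ ∃ a, l = a :: τ) (k : ℕ)
    (hk : k ≤ τ.length) : anc k l = anc k τ := by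
  rcases h with rfl | ⟨a, rfl⟩
  · rfl
  · exact anc_cons k a τ hk

theorem near_length {W : Type*} {τ l : List W} (h : l = τ ∨ ∃ a, l = a :: τ) :
    τ.length ≤ l.length ∧ l.length ≤ τ.length + 1 := by
  rcases h with rfl | ⟨a, rfl⟩
  · omega
  · rw [List.length_cons]; omega

theorem Cov.translate {G : Type*} [Group G] [PseudoMetricSpace G]
    (hinv : ∀ k x y : G, dist (k * x) (k * y) = dist x y) {Y Y' : Set G} {N : ℕ} {r D : ℝ}
    (h : Cov dist Y (fun _ => N) r D) (k : G) (hk : ∀ x ∈ Y', k * x ∈ Y) :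
    Cov dist Y' (fun _ => N) r D :=
  h.pullback (fun x => k * x) hk (fun x _ y _ h => by rwa [hinv] at h)
    (fun x _ y _ h => by rwa [hinv] at h)

theorem Cov.nbhd {X : Type*} [PseudoMetricSpace X] {Y Y' : Set X} {N : ℕ} {r D b : ℝ}
    (h : Cov dist Y (fun _ => N) (r + 2 * b) D) (hk : ∀ x ∈ Y', ∃ y ∈ Y, dist x y ≤ b) :
    Cov dist Y' (fun _ => N) r (D + 2 * b) := by
  have : ∀ x : X, ∃ y : X, x ∈ Y' → y ∈ Y ∧ dist x y ≤ b := by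
    intro x
    by_cases hx : x ∈ Y'
    · obtain ⟨y, h1, h2⟩ := hk x hx
      exact ⟨y, fun _ => ⟨h1, h2⟩⟩
    · exact ⟨x, fun h => absurd h hx⟩
  choose f hf using this
  refine h.pullback f (fun x hx => (hf x hx).1) ?_ ?_
  · intro x hx y hy hxy
    have h1 := (hf x hx).2
    have h2 := (hf y hy).2
    rw [dist_comm] at h2
    linarith [dist_triangle x (f x) y, dist_triangle (f x) (f y) y]
  · intro x hx y hy hxy
    have h1 := (hf x hx).2
    have h2 := (hf y hy).2
    rw [dist_comm] at h1
    linarith [dist_triangle (f x) x (f y), dist_triangle x y (f y)]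

section geometry

variable {G W : Type*} [Group G] [PseudoMetricSpace G] (wd : G → List W)

theorem separation {E : Type*}
    (hgen : ∀ f : G → ℝ, (∀ x y, dist x y ≤ 1 → Near (wd x) (wd y) → f x ≤ f y + 1) →
      ∀ x y, f x ≤ f y + dist x y)
    (lam : G → E) (ξ : G → ℝ) (h0 : ∀ x, 0 ≤ ξ x)
    (h1 : ∀ x y, dist x y ≤ 1 → Near (wd x) (wd y) → lam x = lam y → ξ x ≤ ξ y + 1)
    (h2 : ∀ x y, dist x y ≤ 1 → Near (wd x) (wd y) → lam x ≠ lam y → ξ x ≤ 1)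
    (x y : G) (hxy : lam x ≠ lam y) : ξ x ≤ dist x y := by
  classical
  have := hgen (fun z => if lam z = lam x then ξ z else 0) ?_ x y
  · simpa [Ne.symm hxy] using this
  · intro z z' hd hn
    by_cases hz : lam z = lam x <;> by_cases hz' : lam z' = lam x
    · simp only [hz, hz', if_true]
      exact h1 z z' hd hn (hz.trans hz'.symm)
    · simp only [hz, hz', if_true, if_false]
      linarith [h2 z z' hd hn (fun h => hz' (h.symm.trans hz))]
    · simp only [hz, hz', if_true, if_false]
      linarith [h0 z']
    · simp only [hz, hz', if_false]
      linarith

theorem ball_cov (A B C : Subgroup G) (h : List W → G)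
    (hinv : ∀ k x y : G, dist (k * x) (k * y) = dist x y)
    (hgen : ∀ f : G → ℝ, (∀ x y, dist x y ≤ 1 → Near (wd x) (wd y) → f x ≤ f y + 1) →
      ∀ x y, f x ≤ f y + dist x y)
    (F3 : ∀ g ρ τ, wd g = ρ ++ τ → (wd ((h τ)⁻¹ * g)).length ≤ ρ.length)
    (F4 : ∀ g, (wd g).length ≤ 1 → g ∈ A ∨ g ∈ B)
    (F5 : ∀ g ρ τ, wd g = ρ ++ τ → ∀ c ∈ C, wd (h τ * c) = τ)
    (n : ℕ) (hA : ∀ r, 0 < r → ∃ D, Cov dist (A : Set G) (fun _ => n + 1) r D)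
    (hB : ∀ r, 0 < r → ∃ D, Cov dist (B : Set G) (fun _ => n + 1) r D) (m : ℕ) :
    ∀ r, 0 < r → ∃ D, Cov dist {g | (wd g).length ≤ m} (fun _ => n + 1) r D := by
  have mk : ∀ {Y : Set G}, (∀ r, 0 < r → ∃ D, Cov dist Y (fun _ => n + 1) r D) →
      ∀ r, 0 < r → ∃ D, 0 ≤ D ∧ Cov dist Y (fun _ => n + 1) r D := by
    intro Y hY r hr
    obtain ⟨D, hD⟩ := hY r hr
    exact ⟨max D 0, le_max_right _ _, hD.mono subset_rfl (fun _ _ => le_rfl) le_rfl (le_max_left _ _)⟩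
  have hAB : ∀ r, 0 < r → ∃ D, Cov dist ((A : Set G) ∪ B) (fun _ => n + 1) r D := by
    intro r hr
    obtain ⟨D0, hD0, h0⟩ := mk hA r hr
    obtain ⟨D1, hD1, h1⟩ := mk hB (D0 + 2 * r + 1) (by positivity)
    exact ⟨_, Cov.union h0 h1 hr hD0 hD1 (by linarith)⟩
  induction m with
  | zero =>
    intro r hr
    obtain ⟨D, hD⟩ := hAB r hr
    refine ⟨D, hD.mono ?_ (fun _ _ => le_rfl) le_rfl le_rfl⟩
    intro g hg
    exact F4 g (le_trans hg (by norm_num))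
  | succ m ih =>
    intro r hr
    let Bm : Set G := {g | (wd g).length ≤ m}
    have hne : Bm.Nonempty := by
      refine ⟨h [] * 1, ?_⟩
      have := F5 1 (wd 1) [] (by simp) 1 C.one_mem
      show (wd (h [] * 1)).length ≤ m
      rw [this]; simp
    obtain ⟨D1, hD1, h1⟩ := mk hAB r hr
    have hY1 : Cov dist {g | (wd g).length = m + 1 ∧ r ≤ Metric.infDist g Bm} (fun _ => n + 1) r D1 := by
      refine Cov.disjUnion (fun g => anc m (wd g)) (fun τ => ?_) ?_
      · refine h1.translate hinv (h τ)⁻¹ ?_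
        rintro x ⟨⟨hx, _⟩, hx2⟩
        obtain ⟨ρ, e1, e2⟩ := anc_append m (wd x)
        rw [hx2] at e1
        exact F4 _ ((F3 x ρ τ e1).trans (by omega))
      · rintro x ⟨hx, hxr⟩ y ⟨hy, hyr⟩ hxy
        refine hxr.trans ?_
        classical
        let lam : G → Option (List W) := fun z => if m + 1 ≤ (wd z).length then some (anc m (wd z)) else none
        let ξ : G → ℝ := fun z => Metric.infDist z Bm
        refine separation wd hgen lam ξ (fun z => Metric.infDist_nonneg) ?_ ?_ x y ?_
        · intro z z' hd _ _
          have := Metric.infDist_le_infDist_add_dist (s := Bm) (x := z) (y := z')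
          simp only [ξ]; linarith
        · intro z z' hd hn hl
          by_cases hz : (wd z).length ≤ m
          · have : Metric.infDist z Bm = 0 := Metric.infDist_zero_of_mem hz
            simp only [ξ, this]; norm_num
          by_cases hz' : (wd z').length ≤ m
          · exact (Metric.infDist_le_dist_of_mem (s := Bm) hz').trans hd
          exfalso
          apply hl
          obtain ⟨τ, h1, h2⟩ := hn
          have l1 := near_length h1
          have l2 := near_length h2
          simp only [lam]
          rw [if_pos (by omega), if_pos (by omega), near_anc h1 m (by omega), near_anc h2 m (by omega)]
        · simp only [lam, hx, hy, le_refl, if_true]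
          intro h; exact hxy (Option.some.inj h)
    obtain ⟨D0, hD0⟩ := ih (D1 + 2 * r + 1 + 2 * r) (by positivity)
    have hY0 : Cov dist {g | Metric.infDist g Bm < r} (fun _ => n + 1) (D1 + 2 * r + 1) (max D0 0 + 2 * r) := by
      refine Cov.nbhd (hD0.mono subset_rfl (fun _ _ => le_rfl) le_rfl (le_max_left _ _)) ?_
      intro x hx
      obtain ⟨y, hy, hd⟩ := (Metric.infDist_lt_iff hne).1 hx
      exact ⟨y, hy, hd.le⟩
    refine ⟨_, (Cov.union hY1 hY0 hr hD1 (by positivity) (by linarith)).mono ?_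
      (fun _ _ => le_rfl) le_rfl le_rfl⟩
    intro g hg
    by_cases hlt : Metric.infDist g Bm < r
    · exact Or.inr hlt
    · refine Or.inl ⟨?_, not_lt.1 hlt⟩
      have : ¬ (wd g).length ≤ m := fun h => hlt (by
        rw [Metric.infDist_zero_of_mem (s := Bm) h]; exact hr)
      have hg' : (wd g).length ≤ m + 1 := hg
      omega

theorem tree_cov (A B C : Subgroup G) (h : List W → G)
    (hinv : ∀ k x y : G, dist (k * x) (k * y) = dist x y)
    (hgen : ∀ f : G → ℝ, (∀ x y, dist x y ≤ 1 → Near (wd x) (wd y) → f x ≤ f y + 1) →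
      ∀ x y, f x ≤ f y + dist x y)
    (F1 : ∀ g, ∃ c ∈ C, g = h (wd g) * c)
    (F3 : ∀ g ρ τ, wd g = ρ ++ τ → (wd ((h τ)⁻¹ * g)).length ≤ ρ.length)
    (F4 : ∀ g, (wd g).length ≤ 1 → g ∈ A ∨ g ∈ B)
    (F5 : ∀ g ρ τ, wd g = ρ ++ τ → ∀ c ∈ C, wd (h τ * c) = τ)
    (n : ℕ) (hA : ∀ r, 0 < r → ∃ D, Cov dist (A : Set G) (fun _ => n + 1) r D)
    (hB : ∀ r, 0 < r → ∃ D, Cov dist (B : Set G) (fun _ => n + 1) r D)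
    (hC : ∀ r, 0 < r → ∃ D, Cov dist (C : Set G) (fun _ => n) r D) :
    ∀ r, 0 < r → ∃ D, Cov dist (Set.univ : Set G) (fun _ => n + 1) r D := by
  classical
  intro r hr
  obtain ⟨Λ, hΛ1, hΛr⟩ : ∃ Λ : ℕ, 1 ≤ Λ ∧ r ≤ (Λ : ℝ) / (2 * (n + 1)) / (n + 1) / 2 := by
    obtain ⟨k, hk⟩ := exists_nat_ge (r * (2 * (n + 1)) * (n + 1) * 2)
    refine ⟨k + 1, by omega, ?_⟩
    rw [le_div_iff₀ (by norm_num), le_div_iff₀ (by positivity), le_div_iff₀ (by positivity)]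
    push_cast
    nlinarith
  have hΛ0 : (1 : ℝ) ≤ Λ := by exact_mod_cast hΛ1
  obtain ⟨L, hL⟩ : ∃ L : ℕ, L = 14 * Λ + 1 := ⟨_, rfl⟩
  have hLR : (L : ℝ) = 14 * Λ + 1 := by rw [hL]; push_cast; ring
  have hLpos : 0 < L := by omega
  let q : G → ℕ := fun x => (wd x).length / L
  have hq : ∀ x, L * q x ≤ (wd x).length := fun x => Nat.mul_div_le _ _
  have hq2 : ∀ x, (wd x).length < L * q x + L := fun x => by
    have := Nat.lt_mul_div_succ (wd x).length hLpos
    rw [Nat.mul_add] at this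
    simpa using this
  let τ : G → List W := fun x => anc (L * q x) (wd x)
  have hτlen : ∀ x, (τ x).length = L * q x := fun x => anc_length _ _ (hq x)
  let K : List W → Set G := fun σ => {g | ∃ c ∈ C, g = h σ * c}
  have hKne : ∀ σ, (K σ).Nonempty := fun σ => ⟨h σ * 1, 1, C.one_mem, rfl⟩
  let t : G → ℝ := fun x => Metric.infDist x (K (τ x))
  have ht0 : ∀ x, 0 ≤ t x := fun x => Metric.infDist_nonneg
  have htlip : ∀ x y, τ x = τ y → t x ≤ t y + dist x y := by
    intro x y hxy
    simp only [t]; rw [hxy]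
    exact Metric.infDist_le_infDist_add_dist
  have hlen : ∀ x y, ((wd x).length : ℝ) ≤ (wd y).length + dist x y := by
    refine hgen _ ?_
    rintro x y _ ⟨ρ, h1, h2⟩
    have l1 := near_length h1
    have l2 := near_length h2
    have : (wd x).length ≤ (wd y).length + 1 := by omega
    exact_mod_cast this
  have htlen : ∀ x, ((wd x).length : ℝ) ≤ L * q x + t x := by
    intro x
    have : ((wd x).length : ℝ) - L * q x ≤ t x := by
      refine (Metric.le_infDist (hKne _)).2 ?_
      rintro y ⟨c, hc, rfl⟩
      have h1 := hlen x (h (τ x) * c)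
      obtain ⟨ρ, e1, _⟩ := anc_append (L * q x) (wd x)
      rw [F5 x ρ (τ x) e1 c hc, hτlen] at h1
      push_cast at h1
      linarith
    linarith
  let θ : G → ℝ := fun x => max 0 (min (t x - 2 * Λ) (12 * Λ - t x))
  let w : G → Option (List W) := fun x => if 7 * (Λ : ℝ) ≤ t x then some (τ x) else
    if (τ x).length < L then none else some (anc ((τ x).length - L) (τ x))
  -- behaviour at the places where the marked ancestor changes
  have hjump1 : ∀ z ρ Q, (wd z = ρ ∨ ∃ a, wd z = a :: ρ) → ρ.length + 1 = L * Q →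
      (t z = 0 ∨ (L : ℝ) - 1 ≤ t z) ∧ w z = some (anc (L * Q - L) ρ) := by
    intro z ρ Q hz hQ
    have hQ1 : 1 ≤ Q := by
      rcases Nat.eq_zero_or_pos Q with h | h
      · subst h; omega
      · exact h
    obtain ⟨Q', rfl⟩ : ∃ Q', Q = Q' + 1 := ⟨Q - 1, by omega⟩
    have e1 : L * (Q' + 1) - L = L * Q' := by rw [Nat.mul_add]; omega
    rw [e1]
    rw [Nat.mul_add, Nat.mul_one] at hQ
    rcases hz with hz | ⟨a, hz⟩
    · have hqz : q z = Q' := by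
        simp only [q]; rw [hz]
        apply Nat.div_eq_of_lt_le
        · rw [Nat.mul_comm]; omega
        · rw [Nat.succ_mul, Nat.mul_comm]; omega
      have hτz : τ z = anc (L * Q') ρ := by simp only [τ]; rw [hqz, hz]
      have ht : (L : ℝ) - 1 ≤ t z := by
        have h1 := htlen z
        rw [hqz, hz] at h1
        have h2 : (ρ.length : ℝ) + 1 = L * Q' + L := by exact_mod_cast hQ
        linarith
      refine ⟨Or.inr ht, ?_⟩
      simp only [w]
      rw [if_pos (by linarith), hτz]
    · have hl : (wd z).length = L * Q' + L := by rw [hz, List.length_cons, hQ]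
      have hqz : q z = Q' + 1 := by
        simp only [q]; rw [hl, ← Nat.mul_succ, Nat.mul_div_cancel_left _ hLpos]
      have hτz : τ z = wd z := by
        simp only [τ]; rw [hqz, Nat.mul_succ, ← hl, anc_self]
      have ht : t z = 0 := by
        refine Metric.infDist_zero_of_mem ?_
        rw [hτz]
        exact F1 z
      refine ⟨Or.inl ht, ?_⟩
      simp only [w]
      rw [ht, if_neg (by linarith), hτz, hl, if_neg (by omega), hz, Nat.add_sub_cancel,
        anc_cons _ _ _ (by omega)]
  have hjump : ∀ x y, Near (wd x) (wd y) → τ x ≠ τ y → (t x = 0 ∨ (L : ℝ) - 1 ≤ t x) ∧ w x = w y := by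
    rintro x y ⟨ρ, h1, h2⟩ hne
    have l1 := near_length h1
    have l2 := near_length h2
    by_cases hx : L * q x ≤ ρ.length
    · by_cases hy : L * q y ≤ ρ.length
      · exfalso
        apply hne
        have e1 : q x ≤ q y := (Nat.le_div_iff_mul_le hLpos).2 (by rw [Nat.mul_comm]; omega)
        have e2 : q y ≤ q x := (Nat.le_div_iff_mul_le hLpos).2 (by rw [Nat.mul_comm]; omega)
        have e : q x = q y := le_antisymm e1 e2
        simp only [τ]
        rw [near_anc h1 _ hx, near_anc h2 _ hy, e]
      · have hQ : ρ.length + 1 = L * q y := by have := hq y; omega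
        have a := hjump1 x ρ _ h1 hQ
        have b := hjump1 y ρ _ h2 hQ
        exact ⟨a.1, a.2.trans b.2.symm⟩
    · have hQ : ρ.length + 1 = L * q x := by have := hq x; omega
      have a := hjump1 x ρ _ h1 hQ
      have b := hjump1 y ρ _ h2 hQ
      exact ⟨a.1, a.2.trans b.2.symm⟩
  have hθ0 : ∀ x, 0 ≤ θ x := fun x => le_max_left _ _
  have hθz : ∀ x, (t x = 0 ∨ (L : ℝ) - 1 ≤ t x) → θ x = 0 := by
    rintro x (hx | hx)
    · simp only [θ]
      rw [hx, max_eq_left]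
      exact (min_le_left _ _).trans (by linarith)
    · simp only [θ]
      rw [max_eq_left]
      exact (min_le_right _ _).trans (by linarith)
  have hθadj : ∀ x y, dist x y ≤ 1 → τ x = τ y → θ x ≤ θ y + 1 := by
    intro x y hd hxy
    have h1 := htlip x y hxy
    have h2 := htlip y x hxy.symm
    rw [dist_comm] at h2
    simp only [θ]
    rw [← max_add_add_right, ← min_add_add_right]
    exact max_le_max (by norm_num) (min_le_min (by linarith) (by linarith))
  have hθ : ∀ x y, θ x ≤ θ y + dist x y := by
    refine hgen θ ?_
    intro x y hd hn
    by_cases hxy : τ x = τ y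
    · exact hθadj x y hd hxy
    · rw [hθz x (hjump x y hn hxy).1]
      linarith [hθ0 y]
  have hθpos : ∀ x, 0 < θ x → 2 * Λ < t x ∧ t x < 12 * Λ := by
    intro x hx
    rcases lt_max_iff.1 hx with h | h
    · exact absurd h (lt_irrefl _)
    · have := lt_min_iff.1 h
      constructor <;> linarith [this.1, this.2]
  suffices key : ∃ D, Cov dist (Set.univ : Set G) (fun _ => n + 1) (Λ / (2 * (n + 1)) / (n + 1) / 2) D by
    obtain ⟨D, hD⟩ := key
    exact ⟨D, hD.mono subset_rfl (fun _ _ => le_rfl) hΛr le_rfl⟩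
  refine gluing n (Λ : ℝ) (by linarith) θ τ w hθ0 hθ ?_ ?_ ?_ ?_ ?_
  · refine separation wd hgen τ θ hθ0 (fun x y hd _ h => hθadj x y hd h) ?_
    intro x y hd hn hne
    rw [hθz x (hjump x y hn hne).1]; norm_num
  · intro x y hne hx hy
    have := separation wd hgen τ (fun x => max 0 (min (t x) (L - 1 - t x)))
      (fun x => le_max_left _ _) ?_ ?_ x y hne
    · refine le_trans ?_ this
      have := hθpos x hx
      exact le_max_of_le_right (le_min (by linarith) (by linarith))
    · intro x y hd hn hxy
      have h1 := htlip x y hxy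
      have h2 := htlip y x hxy.symm
      rw [dist_comm] at h2
      rw [← max_add_add_right, ← min_add_add_right]
      exact max_le_max (by norm_num) (min_le_min (by linarith) (by linarith))
    · intro x y hd hn hxy
      refine max_le (by norm_num) ?_
      rcases (hjump x y hn hxy).1 with h | h
      · exact (min_le_left _ _).trans (by linarith)
      · exact (min_le_right _ _).trans (by linarith)
  · intro x y hne hx hy
    have := separation wd hgen w (fun x => max 0 (5 * Λ - θ x))
      (fun x => le_max_left _ _) ?_ ?_ x y hne
    · refine le_trans ?_ this
      exact le_max_of_le_right (by linarith)
    · intro x y hd hn hxy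
      have := hθ y x
      rw [dist_comm] at this
      rw [← max_add_add_right]
      exact max_le_max (by norm_num) (by linarith)
    · intro x y hd hn hxy
      have hτ : τ x = τ y := by
        by_contra h
        exact hxy (hjump x y hn h).2
      have h1 := htlip x y hτ
      have h2 := htlip y x hτ.symm
      rw [dist_comm] at h2
      have ht7 : 7 * Λ - 1 ≤ t x ∧ t x ≤ 7 * Λ + 1 := by
        by_cases hx7 : 7 * (Λ : ℝ) ≤ t x <;> by_cases hy7 : 7 * (Λ : ℝ) ≤ t y
        · exact absurd (by simp only [w, if_pos hx7, if_pos hy7, hτ]) hxy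
        · constructor <;> linarith
        · constructor <;> linarith
        · exact absurd (by simp only [w, if_neg hx7, if_neg hy7, hτ]) hxy
      have : 5 * Λ - 1 ≤ θ x := le_max_of_le_right (le_min (by linarith) (by linarith))
      exact max_le (by norm_num) (by linarith)
  · intro s hs
    obtain ⟨D, hD⟩ := ball_cov wd A B C h hinv hgen F3 F4 F5 n hA hB (2 * L) s hs
    refine ⟨D, ?_⟩
    rintro (_ | σ)
    · refine hD.mono ?_ (fun _ _ => le_rfl) le_rfl le_rfl
      rintro x ⟨_, hx⟩
      simp only [w] at hx
      split_ifs at hx with h1 h2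
      rw [hτlen] at h2
      have h3 := hq2 x
      change (wd x).length ≤ 2 * L
      omega
    · refine hD.translate hinv (h σ)⁻¹ ?_
      rintro x ⟨_, hx⟩
      have h3 := hq2 x
      obtain ⟨ρ, e1, e2⟩ := anc_append (L * q x) (wd x)
      simp only [w] at hx
      split_ifs at hx with h1 h2
      · have hx' : τ x = σ := Option.some.inj hx
        have e3 : wd x = ρ ++ σ := by rw [← hx']; exact e1
        refine (F3 x ρ σ e3).trans ?_
        omega
      · have hx' := Option.some.inj hx
        obtain ⟨ρ', e1', e2'⟩ := anc_append ((τ x).length - L) (τ x)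
        rw [hx'] at e1'
        have e3 : wd x = (ρ ++ ρ') ++ σ := by
          rw [List.append_assoc, ← e1']; exact e1
        refine (F3 x _ σ e3).trans ?_
        rw [List.length_append]
        omega
  · intro s hs
    obtain ⟨D, hD⟩ := hC (s + 2 * (12 * Λ)) (by positivity)
    refine ⟨D + 2 * (12 * Λ), fun σ => ?_⟩
    have hN : Cov dist {z : G | ∃ c ∈ (C : Set G), dist z c ≤ 12 * Λ} (fun _ => n) s (D + 2 * (12 * Λ)) :=
      hD.nbhd (fun x hx => hx)
    refine hN.translate hinv (h σ)⁻¹ ?_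
    rintro x ⟨hx, rfl⟩
    have h1 := (hθpos x hx).2
    obtain ⟨y, ⟨c, hc, rfl⟩, hd⟩ := (Metric.infDist_lt_iff (hKne _)).1 h1
    refine ⟨c, hc, ?_⟩
    rw [← hinv (h (τ x))]
    rw [mul_inv_cancel_left]
    exact hd.le

end geometry

end AmalgAsdim

namespace AmalgAsdim

section NormalForm

open Monoid Monoid.PushoutI Monoid.PushoutI.NormalWord

variable {G : Type*} [Group G] {S : Bool → Subgroup G} {C : Subgroup G}

/-- product in `G` of a list of letters -/
def lprod (S : Bool → Subgroup G) (l : List (Σ b : Bool, S b)) : G :=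
  (l.map (fun p => (p.2 : G))).prod

theorem lprod_append (l l' : List (Σ b : Bool, S b)) :
    lprod S (l ++ l') = lprod S l * lprod S l' := by simp [lprod]

/-- reduced and normalized words -/
def Good (T : ∀ b, Set (S b)) (l : List (Σ b : Bool, S b)) : Prop :=
  (∀ p ∈ l, p.2 ≠ 1) ∧ l.IsChain (fun p q => p.1 ≠ q.1) ∧ ∀ p ∈ l, p.2 ∈ T p.1

theorem Good.left {T : ∀ b, Set (S b)} {l l' : List (Σ b : Bool, S b)} (h : Good T (l ++ l')) :
    Good T l :=
  ⟨fun p hp => h.1 p (by simp [hp]), (List.isChain_append.1 h.2.1).1,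
    fun p hp => h.2.2 p (by simp [hp])⟩

theorem Good.right {T : ∀ b, Set (S b)} {l l' : List (Σ b : Bool, S b)} (h : Good T (l ++ l')) :
    Good T l' :=
  ⟨fun p hp => h.1 p (by simp [hp]), (List.isChain_append.1 h.2.1).2.1,
    fun p hp => h.2.2 p (by simp [hp])⟩

/-- the normal form theorem, transported to `G` -/
theorem exists_normal_form (hS : ∀ b, C ≤ S b)
    (ψ : PushoutI (fun b => Subgroup.inclusion (hS b)) →* G)
    (hof : ∀ b (x : S b), ψ (PushoutI.of b x) = x)
    (hψ : Function.Bijective ψ) :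
    ∃ (T : ∀ b, Set (S b)) (wd : G → List (Σ b : Bool, S b)),
      (∀ b (y : S b), ∃ c ∈ C, ∃ t ∈ T b, (y : G) = c * t) ∧
      (∀ g, Good T (wd g)) ∧ (∀ g, ∃ c ∈ C, g⁻¹ = c * lprod S (wd g)) ∧
      (∀ l, Good T l → ∀ c ∈ C, wd (c * lprod S l)⁻¹ = l) := by
  classical
  obtain ⟨d⟩ := transversal_nonempty (fun b => Subgroup.inclusion (hS b))
    (fun b => Subgroup.inclusion_injective (hS b))
  have hbase : ∀ c : C, ψ (base (fun b => Subgroup.inclusion (hS b)) c) = c := by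
    intro c
    rw [← of_apply_eq_base (fun b => Subgroup.inclusion (hS b)) true c, hof]
    rfl
  have hprod : ∀ w : NormalWord d, ψ w.prod = w.head * lprod S w.toList := by
    intro w
    rw [NormalWord.prod, map_mul, hbase]
    congr 1
    rw [CoprodI.Word.prod, map_list_prod, map_list_prod, lprod, List.map_map, List.map_map]
    congr 1
    apply List.map_congr_left
    intro p hp
    simp [hof]
  let e := Equiv.ofBijective ψ hψ
  let nw : G → NormalWord d := fun g => NormalWord.equiv (e.symm g⁻¹)
  have hnw : ∀ g, ψ (nw g).prod = g⁻¹ := by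
    intro g
    have : (nw g).prod = e.symm g⁻¹ := NormalWord.equiv.symm_apply_apply _
    rw [this]
    exact e.apply_symm_apply _
  refine ⟨d.set, fun g => (nw g).toList, ?_, ?_, ?_, ?_⟩
  · intro b y
    obtain ⟨⟨⟨u, hu⟩, ⟨t, ht⟩⟩, hut⟩ := (d.compl b).2 y
    obtain ⟨c, rfl⟩ := hu
    refine ⟨c, c.2, t, ht, ?_⟩
    rw [← hut]; rfl
  · intro g
    exact ⟨(nw g).ne_one, (nw g).chain_ne, fun p hp => (nw g).normalized p.1 p.2 hp⟩
  · intro g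
    exact ⟨(nw g).head, (nw g).head.2, by rw [← hprod, hnw]⟩
  · intro l hl c hc
    let w : NormalWord d := ⟨⟨l, hl.1, hl.2.1⟩, ⟨c, hc⟩, fun i g hg => hl.2.2 ⟨i, g⟩ hg⟩
    have h1 : ψ w.prod = c * lprod S l := hprod w
    have h2 := hnw (c * lprod S l)⁻¹
    rw [inv_inv, ← h1] at h2
    have h3 := NormalWord.prod_injective (hψ.1 h2)
    show (nw (c * lprod S l)⁻¹).toList = l
    rw [← h1, h3]

theorem interface (hS : ∀ b, C ≤ S b)
    (ψ : PushoutI (fun b => Subgroup.inclusion (hS b)) →* G)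
    (hof : ∀ b (x : S b), ψ (PushoutI.of b x) = x)
    (hψ : Function.Bijective ψ) :
    ∃ (wd : G → List (Σ b : Bool, S b)) (h : List (Σ b : Bool, S b) → G),
      (∀ g, ∃ c ∈ C, g = h (wd g) * c) ∧
      (∀ g ρ τ, wd g = ρ ++ τ → (wd ((h τ)⁻¹ * g)).length ≤ ρ.length) ∧
      (∀ g, (wd g).length ≤ 1 → g ∈ S true ∨ g ∈ S false) ∧
      (∀ g ρ τ, wd g = ρ ++ τ → ∀ c ∈ C, wd (h τ * c) = τ) ∧
      (∀ b, ∀ s ∈ S b, ∀ g, Near (wd g) (wd (g * s))) := by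
  obtain ⟨T, wd, hT, hgood, hinv, hwd⟩ := exists_normal_form hS ψ hof hψ
  refine ⟨wd, fun τ => (lprod S τ)⁻¹, ?_, ?_, ?_, ?_, ?_⟩
  · intro g
    obtain ⟨c, hc, h⟩ := hinv g
    refine ⟨c⁻¹, C.inv_mem hc, ?_⟩
    rw [← mul_inv_rev, ← h, inv_inv]
  · intro g ρ τ hg
    obtain ⟨c, hc, h⟩ := hinv g
    have h1 : ((lprod S τ)⁻¹)⁻¹ * g = (c * lprod S ρ)⁻¹ := by
      rw [hg, lprod_append] at h
      rw [← inv_inv g, h]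
      group
    rw [h1, hwd ρ (Good.left (hg ▸ hgood g)) c hc]
  · intro g hg
    obtain ⟨c, hc, h⟩ := hinv g
    rcases hl : wd g with _ | ⟨⟨b, x⟩, _ | ⟨q, l⟩⟩
    · left
      rw [hl] at h
      simp only [lprod, List.map_nil, List.prod_nil, mul_one] at h
      rw [← inv_mem_iff, h]
      exact hS _ hc
    · rw [hl] at h
      simp only [lprod, List.map_cons, List.map_nil, List.prod_cons, List.prod_nil, mul_one] at h
      have : g ∈ S b := by
        rw [← inv_mem_iff, h]
        exact mul_mem (hS _ hc) x.2
      cases b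
      · exact Or.inr this
      · exact Or.inl this
    · rw [hl] at hg; simp at hg
  · intro g ρ τ hg c hc
    have h1 : (lprod S τ)⁻¹ * c = (c⁻¹ * lprod S τ)⁻¹ := by group
    rw [h1, hwd τ (Good.right (hg ▸ hgood g)) _ (C.inv_mem hc)]
  · intro b s hs g
    have key : ∀ τ, Good T τ → (∀ p ∈ τ.head?, b ≠ p.1) → ∀ y ∈ S b,
        wd (y * lprod S τ)⁻¹ = τ ∨ ∃ a, wd (y * lprod S τ)⁻¹ = a :: τ := by
      intro τ hτ hb y hy
      obtain ⟨c, hc, t, ht, e⟩ := hT b ⟨y, hy⟩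
      simp only at e
      by_cases h1 : t = 1
      · left
        rw [e, h1, OneMemClass.coe_one, mul_one]
        exact hwd τ hτ c hc
      · right
        refine ⟨⟨b, t⟩, ?_⟩
        have h2 : y * lprod S τ = c * lprod S (⟨b, t⟩ :: τ) := by
          rw [e, mul_assoc]; simp [lprod]
        rw [h2]
        refine hwd _ ⟨?_, ?_, ?_⟩ c hc
        · intro p hp
          rcases List.mem_cons.1 hp with rfl | hp
          · exact h1
          · exact hτ.1 p hp
        · exact List.isChain_cons.2 ⟨hb, hτ.2.1⟩
        · intro p hp
          rcases List.mem_cons.1 hp with rfl | hp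
          · exact ht
          · exact hτ.2.2 p hp
    have split : ∃ τ, Good T τ ∧ (∀ p ∈ τ.head?, b ≠ p.1) ∧ ∃ y ∈ S b, g⁻¹ = y * lprod S τ := by
      obtain ⟨c, hc, h⟩ := hinv g
      have hg := hgood g
      rcases hl : wd g with _ | ⟨⟨b', x⟩, τ⟩
      · rw [hl] at h hg
        exact ⟨[], hg, by simp, c, hS _ hc, h⟩
      · rw [hl] at h hg
        by_cases hb : b = b'
        · subst hb
          refine ⟨τ, Good.right (l := [⟨b, x⟩]) hg, (List.isChain_cons.1 hg.2.1).1, c * x,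
            mul_mem (hS _ hc) x.2, ?_⟩
          rw [h, mul_assoc]; simp [lprod]
        · exact ⟨_, hg, by simpa using hb, c, hS _ hc, h⟩
    obtain ⟨τ, hτ, hb, y, hy, e⟩ := split
    refine ⟨τ, ?_, ?_⟩
    · have := key τ hτ hb y hy
      rwa [← e, inv_inv] at this
    · have := key τ hτ hb (s⁻¹ * y) (mul_mem ((S b).inv_mem hs) hy)
      rwa [mul_assoc, ← e, ← mul_inv_rev, inv_inv] at this

end NormalForm

end AmalgAsdim

namespace AmalgAsdim

section Words

variable {G : Type*} [Group G]

theorem exists_word {S : Set G} (hs : ∀ s ∈ S, s⁻¹ ∈ S) {g : G} (hg : g ∈ Subgroup.closure S) :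
    ∃ l : List G, (∀ x ∈ l, x ∈ S) ∧ l.prod = g := by
  rw [← Subgroup.mem_toSubmonoid, Subgroup.closure_toSubmonoid] at hg
  obtain ⟨l, hl, h⟩ := Submonoid.exists_list_of_mem_closure hg
  refine ⟨l, fun x hx => ?_, h⟩
  rcases hl x hx with h | h
  · exact h
  · simpa using hs _ h

theorem countable_closure {S : Set G} (hs : ∀ s ∈ S, s⁻¹ ∈ S) (hf : S.Finite) :
    Countable (Subgroup.closure S) := by
  have := hf.countable.to_subtype
  have h : (Subgroup.closure S : Set G) ⊆
      Set.range (fun l : List S => (l.map Subtype.val).prod) := by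
    intro g hg
    obtain ⟨l, hl, rfl⟩ := exists_word hs hg
    refine ⟨l.attach.map (fun x => ⟨x.1, hl x.1 x.2⟩), ?_⟩
    simp [List.map_map, Function.comp_def]
  exact ((Set.countable_range _).mono h).to_subtype

end Words

section Pushout

open Monoid Monoid.PushoutI Monoid.PushoutI.NormalWord

universe u v

variable {G : Type u} [Group G]

/-- the two factors as a family -/
def fam (A B : Subgroup G) : Bool → Subgroup G := fun b => cond b A B

theorem pushout_countable {S : Bool → Subgroup G} {C : Subgroup G} (hS : ∀ b, C ≤ S b)
    (hc : ∀ b, Countable (S b)) : Countable (PushoutI (fun b => Subgroup.inclusion (hS b))) := by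
  classical
  obtain ⟨d⟩ := transversal_nonempty (fun b => Subgroup.inclusion (hS b))
    (fun b => Subgroup.inclusion_injective (hS b))
  have hC : Countable C := (Subgroup.inclusion_injective (hS true)).countable
  let f : NormalWord d → C × List (Σ b, S b) := fun w => (w.head, w.toList)
  have hf : Function.Injective f := by
    intro w w' h
    exact NormalWord.ext (congrArg Prod.fst h) (congrArg Prod.snd h)
  have := hf.countable
  exact (NormalWord.equiv (d := d)).injective.countable

theorem exists_pushout_lift {S : Bool → Subgroup G} {C : Subgroup G} (hS : ∀ b, C ≤ S b) :
    ∃ ψ : PushoutI (fun b => Subgroup.inclusion (hS b)) →* G,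
      ∀ b (x : S b), ψ (PushoutI.of b x) = x := by
  have h : ∀ b, ((S b).subtype).comp (Subgroup.inclusion (hS b)) = C.subtype := fun b => by
    ext x; rfl
  refine ⟨PushoutI.lift (fun b => (S b).subtype) C.subtype h, fun b x => ?_⟩
  rw [PushoutI.lift_of]; rfl

theorem exists_pushout_iso (A B C : Subgroup G) (hG : IsAmalgamatedProduct.{u, v} G A B C)
    (hA : Countable A) (hB : Countable B) :
    ∃ (hS : ∀ b, C ≤ fam A B b) (ψ : PushoutI (fun b => Subgroup.inclusion (hS b)) →* G),
      (∀ b (x : fam A B b), ψ (PushoutI.of b x) = x) ∧ Function.Bijective ψ := by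
  obtain ⟨hCA, hCB, hcl, huniv⟩ := hG
  have hS : ∀ b, C ≤ fam A B b := by
    rintro (_ | _)
    · exact hCB
    · exact hCA
  have hcount : ∀ b, Countable (fam A B b) := by
    rintro (_ | _)
    · exact hB
    · exact hA
  let φ : ∀ b, C →* fam A B b := fun b => Subgroup.inclusion (hS b)
  obtain ⟨ψ, hof⟩ := exists_pushout_lift hS
  refine ⟨hS, ψ, hof, ?_, ?_⟩
  · have : Countable (PushoutI φ) := pushout_countable hS hcount
    let e : PushoutI φ ≃* Shrink.{v} (PushoutI φ) := Shrink.mulEquiv.symm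
    obtain ⟨f, hfA, hfB⟩ := huniv (H := Shrink.{v} (PushoutI φ))
      (e.toMonoidHom.comp (PushoutI.of (φ := φ) true : A →* PushoutI φ))
      (e.toMonoidHom.comp (PushoutI.of (φ := φ) false : B →* PushoutI φ)) (by
        intro x hxA hxB hxC
        have h1 := of_apply_eq_base φ true ⟨x, hxC⟩
        have h2 := of_apply_eq_base φ false ⟨x, hxC⟩
        have h3 : (PushoutI.of (φ := φ) true : A →* PushoutI φ) ⟨x, hxA⟩
            = (PushoutI.of (φ := φ) false : B →* PushoutI φ) ⟨x, hxB⟩ := h1.trans h2.symm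
        exact congrArg e h3)
    have hfe : f.comp ψ = e.toMonoidHom := by
      apply PushoutI.hom_ext_nonempty
      rintro (_ | _)
      · ext x
        have := hof false x
        simp only [MonoidHom.comp_apply]
        rw [this]
        exact congrArg _ (hfB x)
      · ext x
        have := hof true x
        simp only [MonoidHom.comp_apply]
        rw [this]
        exact congrArg _ (hfA x)
    intro x y hxy
    apply e.injective
    have hx := DFunLike.congr_fun hfe x
    have hy := DFunLike.congr_fun hfe y
    simp only [MonoidHom.comp_apply] at hx hy
    rw [hxy] at hx
    exact hx.symm.trans hy
  · rw [← MonoidHom.range_eq_top, eq_top_iff, ← hcl, Subgroup.closure_le]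
    rintro g (hg | hg)
    · exact ⟨PushoutI.of true (⟨g, hg⟩ : A), hof true ⟨g, hg⟩⟩
    · exact ⟨PushoutI.of false (⟨g, hg⟩ : B), hof false ⟨g, hg⟩⟩

end Pushout

end AmalgAsdim

namespace AmalgAsdim

section Conversion

variable {X : Type*} {d : X → X → ℝ}

theorem cov_of_asdimLE {n : ℕ} (h : AsdimLE d n) (r : ℝ) (hr : 0 < r) :
    ∃ D, Cov d Set.univ (fun _ => n + 1) r D := by
  obtain ⟨𝒰, D, h1, h2, h3⟩ := h r hr
  choose i U hU hx using h3
  refine ⟨D, Cov.of_labels (fun x => (i x : ℕ)) U fun x _ => ⟨(i x).2, fun y _ hc => ?_⟩⟩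
  have hi : i x = i y := Fin.ext hc
  refine ⟨fun e => ?_, fun e => ?_⟩
  · exact h2 (i x) (U x) (hU x) x (hx x) y (e ▸ hx y)
  · exact h1 (i x) (U x) (hU x) (U y) (hi ▸ hU y) e x (hx x) y (hx y)

theorem asdimLE_of_cov {n : ℕ} (h : ∀ r : ℝ, 0 < r → ∃ D, Cov d Set.univ (fun _ => n + 1) r D) :
    AsdimLE d n := by
  intro r hr
  obtain ⟨D, c, l, h⟩ := h r hr
  refine ⟨fun i => {U | ∃ p, U = {x | c x = i ∧ l x = p}}, D, ?_, ?_, ?_⟩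
  · rintro i _ ⟨p, rfl⟩ _ ⟨q, rfl⟩ hne x ⟨hx, hx'⟩ y ⟨hy, hy'⟩
    refine ((h x trivial).2 y trivial (hx.trans hy.symm)).2 ?_
    rintro e
    apply hne
    rw [← hx', ← hy', e]
  · rintro i _ ⟨p, rfl⟩ x ⟨hx, hx'⟩ y ⟨hy, hy'⟩
    exact ((h x trivial).2 y trivial (hx.trans hy.symm)).1 (hx'.trans hy'.symm)
  · intro x
    exact ⟨⟨c x, (h x trivial).1⟩, _, ⟨l x, rfl⟩, rfl, rfl⟩

theorem exists_asdimLE {n : ℕ} (h : asDim d ≤ n) : ∃ k ≤ n, AsdimLE d k := by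
  have hne : {N : ℕ∞ | ∃ n : ℕ, N = (n : ℕ∞) ∧ AsdimLE d n}.Nonempty := by
    by_contra hc
    rw [Set.not_nonempty_iff_eq_empty] at hc
    rw [asDim, hc, sInf_empty] at h
    exact absurd (top_le_iff.1 h) (ENat.coe_ne_top n)
  obtain ⟨k, hk, hd⟩ := csInf_mem hne
  refine ⟨k, ?_, hd⟩
  have : (k : ℕ∞) ≤ n := by rw [← hk]; exact h
  exact_mod_cast this

theorem asDim_le_of_asdimLE {n : ℕ} (h : AsdimLE d n) : asDim d ≤ n := sInf_le ⟨n, rfl, h⟩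

end Conversion

section WordMetric

variable {G : Type*} [Group G]

theorem wordNorm_le {S : Set G} (l : List G) (hl : ∀ x ∈ l, x ∈ S) :
    wordNorm S l.prod ≤ l.length := Nat.sInf_le ⟨l, rfl, hl, rfl⟩

theorem wordNorm_spec {S : Set G} (hs : ∀ s ∈ S, s⁻¹ ∈ S) {g : G} (hg : g ∈ Subgroup.closure S) :
    ∃ l : List G, l.length = wordNorm S g ∧ (∀ x ∈ l, x ∈ S) ∧ l.prod = g := by
  obtain ⟨l, hl, h⟩ := exists_word hs hg
  exact Nat.sInf_mem (s := {k : ℕ | ∃ l : List G, l.length = k ∧ (∀ x ∈ l, x ∈ S) ∧ l.prod = g})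
    ⟨l.length, l, rfl, hl, h⟩

theorem wordNorm_one (S : Set G) : wordNorm S 1 = 0 :=
  Nat.le_zero.1 (wordNorm_le (S := S) [] (by simp))

theorem wordNorm_inv_le {S : Set G} (hs : ∀ s ∈ S, s⁻¹ ∈ S) {g : G}
    (hg : g ∈ Subgroup.closure S) : wordNorm S g⁻¹ ≤ wordNorm S g := by
  obtain ⟨l, h1, h2, rfl⟩ := wordNorm_spec hs hg
  rw [← h1, List.prod_inv_reverse]
  refine (wordNorm_le _ ?_).trans (by simp)
  intro x hx
  simp only [List.mem_reverse, List.mem_map] at hx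
  obtain ⟨y, hy, rfl⟩ := hx
  exact hs _ (h2 y hy)

theorem wordNorm_mul_le {S : Set G} (hs : ∀ s ∈ S, s⁻¹ ∈ S) {g k : G}
    (hg : g ∈ Subgroup.closure S) (hk : k ∈ Subgroup.closure S) :
    wordNorm S (g * k) ≤ wordNorm S g + wordNorm S k := by
  obtain ⟨l, h1, h2, rfl⟩ := wordNorm_spec hs hg
  obtain ⟨l', h1', h2', rfl⟩ := wordNorm_spec hs hk
  rw [← h1, ← h1', ← List.prod_append]
  refine (wordNorm_le _ ?_).trans (by simp)
  intro x hx
  rcases List.mem_append.1 hx with h | h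
  · exact h2 x h
  · exact h2' x h

theorem wordNorm_mono {S S' : Set G} (hs : ∀ s ∈ S, s⁻¹ ∈ S) (hSS : S ⊆ S') {g : G}
    (hg : g ∈ Subgroup.closure S) : wordNorm S' g ≤ wordNorm S g := by
  obtain ⟨l, h1, h2, rfl⟩ := wordNorm_spec hs hg
  rw [← h1]
  exact wordNorm_le _ (fun x hx => hSS (h2 x hx))

theorem finite_ball {S : Set G} (hs : ∀ s ∈ S, s⁻¹ ∈ S) (hf : S.Finite)
    (hS : Subgroup.closure S = ⊤) (n : ℕ) : {g | wordNorm S g ≤ n}.Finite := by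
  have := hf.to_subtype
  refine ((List.finite_length_le S n).image (fun l : List S => (l.map Subtype.val).prod)).subset ?_
  intro g hg
  obtain ⟨l, h1, h2, rfl⟩ := wordNorm_spec (g := g) hs (by rw [hS]; trivial)
  refine ⟨l.attach.map (fun x => ⟨x.1, h2 x.1 x.2⟩), ?_, ?_⟩
  · have hg' : wordNorm S l.prod ≤ n := hg
    simp only [Set.mem_setOf_eq, List.length_map, List.length_attach]
    omega
  · simp [List.map_map, Function.comp_def]

/-- the word metric as a pseudometric space structure -/
@[reducible]
noncomputable def wordSpace (S : Set G) (hs : ∀ s ∈ S, s⁻¹ ∈ S) (hS : Subgroup.closure S = ⊤) :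
    PseudoMetricSpace G where
  dist := wordDist S
  dist_self g := by simp [wordDist, wordNorm_one]
  dist_comm g k := by
    have h : ∀ x y : G, wordNorm S (x⁻¹ * y) ≤ wordNorm S (y⁻¹ * x) := by
      intro x y
      have := wordNorm_inv_le (g := y⁻¹ * x) hs (by rw [hS]; trivial)
      rwa [mul_inv_rev, inv_inv] at this
    exact congrArg Nat.cast (le_antisymm (h g k) (h k g))
  dist_triangle x y z := by
    have := wordNorm_mul_le (g := x⁻¹ * y) (k := y⁻¹ * z) hs (by rw [hS]; trivial)
      (by rw [hS]; trivial)
    rw [show x⁻¹ * y * (y⁻¹ * z) = x⁻¹ * z by group] at this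
    simp only [wordDist]
    exact_mod_cast this

/-- a finitely generated subgroup is coarsely embedded -/
theorem cov_subgroup {A : Subgroup G} {SA S : Set G} (hsub : SA ⊆ S)
    (hsA : ∀ s ∈ SA, s⁻¹ ∈ SA) (hs : ∀ s ∈ S, s⁻¹ ∈ S) (hf : S.Finite)
    (hSA : Subgroup.closure SA = A) (hS : Subgroup.closure S = ⊤) {n : ℕ}
    (h : asDim (fun a b : A => wordDist SA (a : G) (b : G)) ≤ n) (r : ℝ) (hr : 0 < r) :
    ∃ D, Cov (wordDist S) (A : Set G) (fun _ => n + 1) r D := by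
  classical
  obtain ⟨k, hk, hd⟩ := exists_asdimLE h
  obtain ⟨R, hR⟩ := ((finite_ball hs hf hS ⌈r⌉₊).image (wordNorm SA)).bddAbove
  obtain ⟨D, hD⟩ := cov_of_asdimLE hd (R + 1) (by positivity)
  refine ⟨D, ?_⟩
  have hD' := hD.mono (N' := fun _ => n + 1) subset_rfl (fun _ _ => by simpa using hk) le_rfl le_rfl
  refine hD'.pullback (fun g => if hg : g ∈ A then ⟨g, hg⟩ else 1) (fun _ _ => trivial) ?_ ?_
  · intro x hx y hy hxy
    have hx' : x ∈ A := hx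
    have hy' : y ∈ A := hy
    simp only [hx', hy', dif_pos] at hxy
    refine le_trans ?_ hxy
    have := wordNorm_mono (g := x⁻¹ * y) hsA hsub
      (by rw [hSA]; exact mul_mem (inv_mem hx') hy')
    simp only [wordDist]
    exact_mod_cast this
  · intro x hx y hy hxy
    have hx' : x ∈ A := hx
    have hy' : y ∈ A := hy
    simp only [hx', hy', dif_pos] at hxy
    by_contra hlt
    push Not at hlt
    simp only [wordDist] at hxy hlt
    have h1 : wordNorm S (x⁻¹ * y) ≤ ⌈r⌉₊ := by
      have := hlt.trans_le (Nat.le_ceil r)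
      exact_mod_cast this.le
    have h2 : wordNorm SA (x⁻¹ * y) ≤ R := hR ⟨_, h1, rfl⟩
    have h3 : (wordNorm SA (x⁻¹ * y) : ℝ) ≤ R := by exact_mod_cast h2
    linarith

theorem cov_restricted {C : Subgroup G} {S : Set G} {n k : ℕ}
    (hd : AsdimLE (fun a b : C => wordDist S (a : G) (b : G)) k) (hk : k + 1 ≤ n)
    (r : ℝ) (hr : 0 < r) :
    ∃ D, Cov (wordDist S) (C : Set G) (fun _ => n) r D := by
  classical
  obtain ⟨D, hD⟩ := cov_of_asdimLE hd r hr
  refine ⟨D, ?_⟩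
  have hD' := hD.mono (N' := fun _ => n) subset_rfl (fun _ _ => hk) le_rfl le_rfl
  refine hD'.pullback (fun g => if hg : g ∈ C then ⟨g, hg⟩ else 1) (fun _ _ => trivial) ?_ ?_
  · intro x hx y hy hxy
    have hx' : x ∈ C := hx
    have hy' : y ∈ C := hy
    simpa only [hx', hy', dif_pos] using hxy
  · intro x hx y hy hxy
    have hx' : x ∈ C := hx
    have hy' : y ∈ C := hy
    simpa only [hx', hy', dif_pos] using hxy

end WordMetric

theorem main_nat {G : Type*} [Group G] (A B C : Subgroup G)
    (hG : IsAmalgamatedProduct G A B C)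
    (SA SB : Set G) (hSAfin : SA.Finite) (hSBfin : SB.Finite)
    (hSAsymm : ∀ s ∈ SA, s⁻¹ ∈ SA) (hSBsymm : ∀ s ∈ SB, s⁻¹ ∈ SB)
    (hSAgen : Subgroup.closure SA = A) (hSBgen : Subgroup.closure SB = B) (n k : ℕ)
    (hA : asDim (fun a b : A => wordDist SA (a : G) (b : G)) ≤ n)
    (hB : asDim (fun a b : B => wordDist SB (a : G) (b : G)) ≤ n)
    (hC : AsdimLE (fun c c' : C => wordDist (SA ∪ SB) (c : G) (c' : G)) k) (hk : k + 1 ≤ n) :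
    AsdimLE (fun g h : G => wordDist (SA ∪ SB) g h) n := by
  have hs : ∀ s ∈ SA ∪ SB, s⁻¹ ∈ SA ∪ SB := by
    rintro s (h | h)
    · exact Or.inl (hSAsymm s h)
    · exact Or.inr (hSBsymm s h)
  have hS : Subgroup.closure (SA ∪ SB) = ⊤ := by
    rw [Subgroup.closure_union, hSAgen, hSBgen, ← hG.2.2.1, Subgroup.closure_union,
      Subgroup.closure_eq, Subgroup.closure_eq]
  have hf := hSAfin.union hSBfin
  have hAc : Countable A := by rw [← hSAgen]; exact countable_closure hSAsymm hSAfin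
  have hBc : Countable B := by rw [← hSBgen]; exact countable_closure hSBsymm hSBfin
  obtain ⟨hle, ψ, hof, hψ⟩ := exists_pushout_iso A B C hG hAc hBc
  obtain ⟨wd, h, F1, F3, F4, F5, hnear⟩ := interface hle ψ hof hψ
  letI : PseudoMetricSpace G := wordSpace (SA ∪ SB) hs hS
  have hdist : ∀ x y : G, dist x y = wordDist (SA ∪ SB) x y := fun _ _ => rfl
  refine asdimLE_of_cov ?_
  refine tree_cov wd A B C h ?_ ?_ F1 F3 F4 F5 n
    (cov_subgroup Set.subset_union_left hSAsymm hs hf hSAgen hS hA)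
    (cov_subgroup Set.subset_union_right hSBsymm hs hf hSBgen hS hB)
    (cov_restricted hC hk)
  · intro g x y
    simp only [hdist, wordDist]
    congr 2
    group
  · intro f hfn x y
    have key : ∀ l : List G, (∀ s ∈ l, s ∈ SA ∪ SB) → ∀ x, f x ≤ f (x * l.prod) + l.length := by
      intro l
      induction l with
      | nil => intro _ x; simp
      | cons s l ih =>
        intro hl x
        have h1 := ih (fun t ht => hl t (List.mem_cons_of_mem _ ht)) (x * s)
        have hsm : s ∈ SA ∪ SB := hl s List.mem_cons_self
        have h2 : f x ≤ f (x * s) + 1 := by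
          refine hfn _ _ ?_ ?_
          · simp only [hdist, wordDist, inv_mul_cancel_left]
            have := wordNorm_le (S := SA ∪ SB) [s] (by simpa using hsm)
            simp only [List.prod_singleton, List.length_singleton] at this
            exact_mod_cast this
          · rcases hsm with hsm | hsm
            · exact hnear true s (show s ∈ A by rw [← hSAgen]; exact Subgroup.subset_closure hsm) x
            · exact hnear false s (show s ∈ B by rw [← hSBgen]; exact Subgroup.subset_closure hsm) x
        rw [mul_assoc] at h1
        rw [List.prod_cons, List.length_cons]
        push_cast
        linarith
    obtain ⟨l, h1, h2, h3⟩ := wordNorm_spec (g := x⁻¹ * y) hs (by rw [hS]; trivial)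
    have := key l h2 x
    rw [h3, h1, mul_inv_cancel_left] at this
    exact this

end AmalgAsdim

/-- **Theorem 2.1.** If `G = A *_C B` is the amalgamated product of finitely
generated groups `A` and `B` over a common subgroup `C`, then
`asdim (A *_C B) ≤ max {asdim A, asdim B, asdim C + 1}`, where `A` and `B`
carry their word metrics (of finite symmetric generating sets `S_A`, `S_B`),
`G = A *_C B` carries the word metric of `S_A ∪ S_B`, and `C` carries the
metric restricted from `A *_C B`. -/
theorem asdim_amalgamated_product_le {G : Type*} [Group G] (A B C : Subgroup G)
    (hG : IsAmalgamatedProduct G A B C)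
    (SA SB : Set G) (hSAfin : SA.Finite) (hSBfin : SB.Finite)
    (hSAsymm : ∀ s ∈ SA, s⁻¹ ∈ SA) (hSBsymm : ∀ s ∈ SB, s⁻¹ ∈ SB)
    (hSAgen : Subgroup.closure SA = A) (hSBgen : Subgroup.closure SB = B) :
    asDim (fun g h : G => wordDist (SA ∪ SB) g h) ≤
      max (max (asDim (fun a b : A => wordDist SA (↑a) (↑b)))
               (asDim (fun a b : B => wordDist SB (↑a) (↑b))))
          (asDim (fun c c' : C => wordDist (SA ∪ SB) (↑c) (↑c')) + 1) := by
  set N := max (max (asDim (fun a b : A => wordDist SA (↑a) (↑b)))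
               (asDim (fun a b : B => wordDist SB (↑a) (↑b))))
          (asDim (fun c c' : C => wordDist (SA ∪ SB) (↑c) (↑c')) + 1) with hN
  by_cases hT : N = ⊤
  · rw [hT]; exact le_top
  · obtain ⟨n, hn⟩ := ENat.ne_top_iff_exists.1 hT
    have hle : N ≤ n := hn.ge
    have hA := ((le_max_left _ _).trans (le_max_left _ _)).trans (hN ▸ hle)
    have hB := ((le_max_right _ _).trans (le_max_left _ _)).trans (hN ▸ hle)
    have hC := (le_max_right _ _).trans (hN ▸ hle)
    have hC1 : asDim (fun c c' : C => wordDist (SA ∪ SB) (c : G) (c' : G)) ≤ n :=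
      le_self_add.trans hC
    obtain ⟨m, hm⟩ := ENat.ne_top_iff_exists.1 (ne_top_of_le_ne_top (ENat.coe_ne_top n) hC1)
    obtain ⟨k, hk, hCk⟩ := AmalgAsdim.exists_asdimLE hm.ge
    rw [← hm] at hC
    have hmn : m + 1 ≤ n := by exact_mod_cast hC
    rw [← hn]
    exact AmalgAsdim.asDim_le_of_asdimLE (AmalgAsdim.main_nat A B C hG SA SB hSAfin hSBfin
      hSAsymm hSBsymm hSAgen hSBgen n k hA hB hCk (by omega))
end

section
/- Let A and B be finitely generated groups. Then asdim(A * B) ≤ max{asdim A, asdim B, 1}, where A * B denotes the free product with the word metric of the union of finite symmetric generating sets of A and B. -/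
namespace AsdimFree

structure IsNorm {G : Type*} [Group G] (N : G → ℕ) : Prop where
  one : N 1 = 0
  mul : ∀ x y, N (x * y) ≤ N x + N y
  inv : ∀ x, N x⁻¹ = N x

theorem IsNorm.comm {G : Type*} [Group G] {N : G → ℕ} (h : IsNorm N) (x y : G) :
    N (y * x⁻¹) = N (x * y⁻¹) := by
  rw [← h.inv]; simp

theorem IsNorm.tri {G : Type*} [Group G] {N : G → ℕ} (h : IsNorm N) (x y z : G) :
    N (x * z⁻¹) ≤ N (x * y⁻¹) + N (y * z⁻¹) := by
  have := h.mul (x * y⁻¹) (y * z⁻¹)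
  simpa [mul_assoc] using this

theorem IsNorm.lip {G : Type*} [Group G] {N : G → ℕ} (h : IsNorm N) (x y : G) :
    N x ≤ N (x * y⁻¹) + N y := by
  have := h.mul (x * y⁻¹) y
  simpa [mul_assoc] using this

/-- colouring form of `asdim ≤ n` at scale `r`. -/
def Good {G : Type*} [Group G] (N : G → ℕ) {n : ℕ} {L : Type*} (r D : ℕ)
    (c : G → Fin (n + 1)) (l : G → L) : Prop :=
  (∀ x y, N (x * y⁻¹) < r → c x = c y → l x = l y) ∧
  (∀ x y, c x = c y → l x = l y → N (x * y⁻¹) ≤ D)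

theorem good_mod {G : Type*} [Group G] {N : G → ℕ} (hN : IsNorm N) {n : ℕ} {L : Type*}
    {r D : ℕ} {c : G → Fin (n + 1)} {l : G → L} (h : Good N r D c l) (M : ℕ) :
    ∃ (c' : Fin (n + 1) → G → Fin (n + 1)) (l' : Fin (n + 1) → G → Option L),
      ∀ τ, (∀ x, N x < M → c' τ x = τ) ∧ Good N r (2 * (M + D + r)) (c' τ) (l' τ) := by
  classical
  let Near : Fin (n + 1) → G → Prop := fun τ x => N x < M ∨
    (c x = τ ∧ ∃ z z', N z < M ∧ N (z * z'⁻¹) < r ∧ c z' = c x ∧ l z' = l x)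
  refine ⟨fun τ x => if N x < M then τ else c x,
    fun τ x => if Near τ x then none else some (l x), fun τ => ⟨?_, ?_, ?_⟩⟩
  · intro x hx; simp [hx]
  · intro x y hxy hc
    by_cases hx : N x < M <;> by_cases hy : N y < M
    · have h1 : Near τ x := Or.inl hx
      have h2 : Near τ y := Or.inl hy
      simp [h1, h2]
    · simp only [hx, hy, if_true, if_false] at hc
      have h1 : Near τ x := Or.inl hx
      have h2 : Near τ y := Or.inr ⟨hc.symm, x, y, hx, hxy, rfl, rfl⟩
      simp [h1, h2]
    · simp only [hx, hy, if_true, if_false] at hc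
      have h1 : Near τ x := Or.inr ⟨hc, y, x, hy, by rw [hN.comm]; exact hxy, rfl, rfl⟩
      have h2 : Near τ y := Or.inl hy
      simp [h1, h2]
    · simp only [hx, hy, if_false] at hc
      have hl := h.1 x y hxy hc
      have : Near τ x ↔ Near τ y := by simp only [Near, hx, hy, hc, hl]
      simp only [this, hl]
  · intro x y hc hl
    have key : ∀ x, Near τ x → ∃ z, N z < M ∧ N (x * z⁻¹) ≤ D + r := by
      rintro x (hx | ⟨_, z, z', hz, hzz, hc', hl'⟩)
      · exact ⟨x, hx, by simp [hN.one]⟩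
      · refine ⟨z, hz, ?_⟩
        have h1 := hN.tri x z' z
        have h2 := h.2 x z' hc'.symm hl'.symm
        have h3 := hN.comm z z'
        omega
    by_cases hx : Near τ x <;> by_cases hy : Near τ y
    · obtain ⟨z, hz, hz'⟩ := key x hx
      obtain ⟨w, hw, hw'⟩ := key y hy
      have h1 := hN.lip x z
      have h2 := hN.lip y w
      have h3 := hN.mul x y⁻¹
      have h4 := hN.inv y
      omega
    · simp [hx, hy] at hl
    · simp [hx, hy] at hl
    · simp only [hx, hy, if_false, Option.some.injEq] at hl
      have hx' : ¬ N x < M := fun h => hx (Or.inl h)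
      have hy' : ¬ N y < M := fun h => hy (Or.inl h)
      simp only [hx', hy', if_false] at hc
      have := h.2 x y hc hl
      omega

/-! ### Words -/

section words

variable {ι : Type*} {H : ι → Type*} [∀ i, Group (H i)]

def wt (N : ∀ i, H i → ℕ) : List (Σ i, H i) → ℕ
  | [] => 0
  | z :: w => N z.1 z.2 + wt N w

theorem wt_append (N : ∀ i, H i → ℕ) (u v : List (Σ i, H i)) :
    wt N (u ++ v) = wt N u + wt N v := by
  induction u with
  | nil => simp [wt]
  | cons z u ih => simp [wt, ih, add_assoc]

open Classical in
noncomputable def pk (i : ι) (a : H i) (t : List (Σ i, H i)) : List (Σ i, H i) :=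
  if a = 1 then t else ⟨i, a⟩ :: t

def Dec (N : ∀ i, H i → ℕ) (W w : List (Σ i, H i)) (k : ℕ) : Prop :=
  (∃ u v p, W = u ++ p ∧ w = v ++ p ∧ wt N u + wt N v ≤ k) ∨
  (∃ (i : ι) (x y : H i) (u v p : List (Σ i, H i)), W = u ++ ⟨i, x⟩ :: p ∧ w = v ++ ⟨i, y⟩ :: p ∧
    N i (x * y⁻¹) + wt N u + wt N v ≤ k)

theorem dec_step {N : ∀ i, H i → ℕ} (hN : ∀ i, IsNorm (N i)) {i : ι} {a s : H i}
    {t w : List (Σ i, H i)} {k : ℕ} (hs : N i s ≤ 1) (h : Dec N (pk i a t) w k) :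
    Dec N (pk i (s * a) t) w (k + 1) := by
  by_cases ha : a = 1
  · subst ha
    by_cases hsa : s * 1 = 1
    · rw [hsa]
      rcases h with ⟨u, v, p, h1, h2, h3⟩ | ⟨j, x, y, u, v, p, h1, h2, h3⟩
      · exact Or.inl ⟨u, v, p, h1, h2, by omega⟩
      · exact Or.inr ⟨j, x, y, u, v, p, h1, h2, by omega⟩
    · rw [pk, if_pos rfl] at h
      rw [pk, if_neg hsa]
      rcases h with ⟨u, v, p, h1, h2, h3⟩ | ⟨j, x, y, u, v, p, h1, h2, h3⟩
      · refine Or.inl ⟨⟨i, s * 1⟩ :: u, v, p, by simp [h1], h2, ?_⟩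
        simp only [wt, mul_one]; omega
      · refine Or.inr ⟨j, x, y, ⟨i, s * 1⟩ :: u, v, p, by simp [h1], h2, ?_⟩
        simp only [wt, mul_one]; omega
  · rw [pk, if_neg ha] at h
    have hmul := (hN i).mul s a
    by_cases hsa : s * a = 1
    · rw [pk, if_pos hsa]
      rcases h with ⟨u, v, p, h1, h2, h3⟩ | ⟨j, x, y, u, v, p, h1, h2, h3⟩
      · cases u with
        | nil =>
          simp only [List.nil_append] at h1
          refine Or.inl ⟨[], v ++ [⟨i, a⟩], t, rfl, by simp [h2, ← h1], ?_⟩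
          have : a = s⁻¹ := by rw [eq_inv_iff_mul_eq_one]; exact mul_eq_one_comm.mp hsa
          have h4 : N i a ≤ 1 := by rw [this, (hN i).inv]; exact hs
          simp only [wt, wt_append] at h3 ⊢; omega
        | cons z u =>
          simp only [List.cons_append, List.cons.injEq] at h1
          refine Or.inl ⟨u, v, p, h1.2, h2, ?_⟩
          simp only [wt] at h3; omega
      · cases u with
        | nil =>
          simp only [List.nil_append, List.cons.injEq] at h1
          obtain ⟨h1, rfl⟩ := h1
          obtain ⟨rfl, h1⟩ := Sigma.mk.inj h1
          obtain rfl := eq_of_heq h1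
          refine Or.inl ⟨[], v ++ [⟨i, y⟩], t, rfl, by simp [h2], ?_⟩
          have h5 := (hN i).mul s (a * y⁻¹)
          rw [← mul_assoc, hsa, one_mul, (hN i).inv] at h5
          simp only [wt, wt_append] at h3 ⊢; omega
        | cons z u =>
          simp only [List.cons_append, List.cons.injEq] at h1
          refine Or.inr ⟨j, x, y, u, v, p, h1.2, h2, ?_⟩
          simp only [wt] at h3; omega
    · rw [pk, if_neg hsa]
      rcases h with ⟨u, v, p, h1, h2, h3⟩ | ⟨j, x, y, u, v, p, h1, h2, h3⟩
      · cases u with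
        | nil =>
          simp only [List.nil_append] at h1
          refine Or.inr ⟨i, s * a, a, [], v, t, rfl, by simp [h2, ← h1], ?_⟩
          simp only [wt, mul_inv_cancel_right] at h3 ⊢; omega
        | cons z u =>
          simp only [List.cons_append, List.cons.injEq] at h1
          obtain ⟨rfl, h1⟩ := h1
          refine Or.inl ⟨⟨i, s * a⟩ :: u, v, p, by simp [h1], h2, ?_⟩
          simp only [wt] at h3 ⊢; omega
      · cases u with
        | nil =>
          simp only [List.nil_append, List.cons.injEq] at h1
          obtain ⟨h1, rfl⟩ := h1
          obtain ⟨rfl, h1⟩ := Sigma.mk.inj h1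
          obtain rfl := eq_of_heq h1
          refine Or.inr ⟨i, s * a, y, [], v, t, rfl, h2, ?_⟩
          have h5 := (hN i).mul s (a * y⁻¹)
          rw [← mul_assoc] at h5
          simp only [wt] at h3 ⊢; omega
        | cons z u =>
          simp only [List.cons_append, List.cons.injEq] at h1
          obtain ⟨rfl, h1⟩ := h1
          refine Or.inr ⟨j, x, y, ⟨i, s * a⟩ :: u, v, p, by simp [h1], h2, ?_⟩
          simp only [wt] at h3 ⊢; omega

/-! ### Colouring of words -/

def swp {n : ℕ} (j : Fin (n + 1)) : Fin (n + 1) := if j = 0 then Fin.last n else 0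

theorem swp_ne {n : ℕ} (hn : 1 ≤ n) (j : Fin (n + 1)) : swp j ≠ j := by
  unfold swp
  split_ifs with h
  · subst h
    intro h
    have := congrArg Fin.val h
    simp at this
    omega
  · exact fun h' => h h'.symm

def kap {n : ℕ} (j : Fin (n + 1)) (q : ℕ) : Fin (n + 1) := if q % 2 = 0 then j else swp j

theorem kap_inj {n : ℕ} (hn : 1 ≤ n) (j : Fin (n + 1)) {q q' : ℕ} (h : kap j q = kap j q') :
    q % 2 = q' % 2 := by
  have := swp_ne hn j
  unfold kap at h
  split_ifs at h with h1 h2 h2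
  · omega
  · exact absurd h.symm this
  · exact absurd h this
  · omega

theorem level_eq {n : ℕ} (hn : 1 ≤ n) (j : Fin (n + 1)) {r a b : ℕ} (hr : 1 ≤ r)
    (h1 : a < b + r) (h2 : b < a + r)
    (h : kap j (a / (4 * r)) = kap j (b / (4 * r))) : a / (4 * r) = b / (4 * r) := by
  have hm := kap_inj hn j h
  have e1 : a / (4 * r) ≤ b / (4 * r) + 1 := by
    rw [← Nat.add_div_right _ (by omega)]
    exact Nat.div_le_div_right (by omega)
  have e2 : b / (4 * r) ≤ a / (4 * r) + 1 := by
    rw [← Nat.add_div_right _ (by omega)]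
    exact Nat.div_le_div_right (by omega)
  omega

structure State (n : ℕ) {ι : Type*} (H : ι → Type*) (L : ι → Type*) where
  j : Fin (n + 1)
  s : ℕ
  b : Option (List (Σ i, H i) × Σ i, L i)

variable {n : ℕ} {L : ι → Type*}

def tau (r : ℕ) (σ : State n H L) : Fin (n + 1) := swp (kap σ.j (σ.s / (4 * r) + 1))

def small (N : ∀ i, H i → ℕ) (r : ℕ) (σ : State n H L) (x : Σ i, H i) : Prop :=
  σ.s + N x.1 x.2 < (σ.s / (4 * r) + 1) * (4 * r) + 2 * r

open Classical in
noncomputable def st (N : ∀ i, H i → ℕ) (r : ℕ) (c : ∀ i, Fin (n + 1) → H i → Fin (n + 1))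
    (l : ∀ i, Fin (n + 1) → H i → L i) : List (Σ i, H i) → State n H L
  | [] => ⟨0, 0, none⟩
  | x :: w =>
    if small N r (st N r c l w) x then
      ⟨(st N r c l w).j, (st N r c l w).s + N x.1 x.2, (st N r c l w).b⟩
    else ⟨c x.1 (tau r (st N r c l w)) x.2, 0,
      some (w, ⟨x.1, l x.1 (tau r (st N r c l w)) x.2⟩)⟩

noncomputable def anc (N : ∀ i, H i → ℕ) (r : ℕ) (c : ∀ i, Fin (n + 1) → H i → Fin (n + 1))
    (l : ∀ i, Fin (n + 1) → H i → L i) (T : ℕ) : List (Σ i, H i) → List (Σ i, H i)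
  | [] => []
  | x :: w => if (st N r c l (x :: w)).s < T then x :: w else anc N r c l T w

noncomputable def col (N : ∀ i, H i → ℕ) (r : ℕ) (c : ∀ i, Fin (n + 1) → H i → Fin (n + 1))
    (l : ∀ i, Fin (n + 1) → H i → L i) (w : List (Σ i, H i)) : Fin (n + 1) :=
  kap (st N r c l w).j ((st N r c l w).s / (4 * r))

noncomputable def lab (N : ∀ i, H i → ℕ) (r : ℕ) (c : ∀ i, Fin (n + 1) → H i → Fin (n + 1))
    (l : ∀ i, Fin (n + 1) → H i → L i) (w : List (Σ i, H i)) :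
    Option (List (Σ i, H i) × Σ i, L i) ⊕ List (Σ i, H i) :=
  if (st N r c l w).s / (4 * r) = 0 then Sum.inl (st N r c l w).b
  else Sum.inr (anc N r c l ((st N r c l w).s / (4 * r) * (4 * r) - r) w)

variable {N : ∀ i, H i → ℕ} {r : ℕ} {c : ∀ i, Fin (n + 1) → H i → Fin (n + 1)}
    {l : ∀ i, Fin (n + 1) → H i → L i}

theorem st_small {x : Σ i, H i} {w : List (Σ i, H i)} (h : small N r (st N r c l w) x) :
    st N r c l (x :: w) =
      ⟨(st N r c l w).j, (st N r c l w).s + N x.1 x.2, (st N r c l w).b⟩ := by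
  rw [st, if_pos h]

theorem st_big {x : Σ i, H i} {w : List (Σ i, H i)} (h : ¬ small N r (st N r c l w) x) :
    st N r c l (x :: w) = ⟨c x.1 (tau r (st N r c l w)) x.2, 0,
      some (w, ⟨x.1, l x.1 (tau r (st N r c l w)) x.2⟩)⟩ := by
  rw [st, if_neg h]

theorem lt_next (hr : 1 ≤ r) (s : ℕ) : s < (s / (4 * r) + 1) * (4 * r) := by
  rw [mul_comm]; exact Nat.lt_mul_div_succ s (by omega)

theorem st_append (hr : 1 ≤ r) (u p : List (Σ i, H i)) (hu : wt N u < r) :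
    st N r c l (u ++ p) =
      ⟨(st N r c l p).j, (st N r c l p).s + wt N u, (st N r c l p).b⟩ := by
  induction u with
  | nil => simp [wt]
  | cons z u ih =>
    simp only [wt] at hu
    have ih := ih (by omega)
    have hsm : small N r (st N r c l (u ++ p)) z := by
      unfold small
      have := lt_next hr (st N r c l (u ++ p)).s
      omega
    rw [List.cons_append, st_small hsm, ih]
    simp only [wt, State.mk.injEq, true_and, and_true]
    omega

theorem anc_append (hr : 1 ≤ r) (T : ℕ) (u p : List (Σ i, H i)) (hu : wt N u < r)
    (hT : T ≤ (st N r c l p).s) :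
    anc N r c l T (u ++ p) = anc N r c l T p := by
  induction u with
  | nil => simp
  | cons z u ih =>
    have h1 := st_append (N := N) (c := c) (l := l) hr (z :: u) p hu
    simp only [wt] at hu
    have ih := ih (by omega)
    rw [List.cons_append] at h1 ⊢
    rw [anc, if_neg, ih]
    rw [h1]
    simp only [wt]
    omega

theorem compat_a (hn : 1 ≤ n) (hr : 1 ≤ r) (u v p : List (Σ i, H i))
    (huv : wt N u + wt N v < r) (hc : col N r c l (u ++ p) = col N r c l (v ++ p)) :
    lab N r c l (u ++ p) = lab N r c l (v ++ p) := by
  have hu := st_append (N := N) (c := c) (l := l) hr u p (by omega)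
  have hv := st_append (N := N) (c := c) (l := l) hr v p (by omega)
  unfold col at hc
  unfold lab
  rw [hu, hv] at hc
  rw [hu, hv]
  simp only at hc ⊢
  have hq := level_eq hn _ hr (by omega) (by omega) hc
  rw [hq]
  split_ifs with h0
  · rfl
  · have e1 := Nat.div_mul_le_self ((st N r c l p).s + wt N u) (4 * r)
    rw [hq] at e1
    have e2 := Nat.div_mul_le_self ((st N r c l p).s + wt N v) (4 * r)
    rw [anc_append hr _ u p (by omega) (by omega), anc_append hr _ v p (by omega) (by omega)]

theorem mixed (hn : 1 ≤ n) (hr : 1 ≤ r) (hN : ∀ i, IsNorm (N i))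
    (hball : ∀ i τ x, N i x < 7 * r → c i τ x = τ) {i : ι} (x y : H i)
    (u v p : List (Σ i, H i)) (huv : N i (x * y⁻¹) + wt N u + wt N v < r)
    (hx : small N r (st N r c l p) ⟨i, x⟩) (hy : ¬ small N r (st N r c l p) ⟨i, y⟩) :
    col N r c l (u ++ ⟨i, x⟩ :: p) ≠ col N r c l (v ++ ⟨i, y⟩ :: p) := by
  have hu := st_append (N := N) (c := c) (l := l) hr u (⟨i, x⟩ :: p) (by omega)
  have hv := st_append (N := N) (c := c) (l := l) hr v (⟨i, y⟩ :: p) (by omega)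
  rw [st_small hx] at hu
  rw [st_big hy] at hv
  unfold col
  rw [hu, hv]
  simp only [zero_add]
  unfold small at hx hy
  simp only at hx hy
  have h1 := (hN i).lip y x
  rw [(hN i).comm] at h1
  have hlow := Nat.div_mul_le_self (st N r c l p).s (4 * r)
  have hb : N i y < 7 * r := by
    rw [add_mul] at hx; omega
  rw [hball i _ y hb]
  have hq0 : wt N v / (4 * r) = 0 := Nat.div_eq_of_lt (by omega)
  have hq1 : ((st N r c l p).s + N i x + wt N u) / (4 * r) = (st N r c l p).s / (4 * r) + 1 := by
    apply Nat.div_eq_of_lt_le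
    · omega
    · rw [add_mul _ 1]; omega
  rw [hq0, hq1]
  unfold tau
  conv_rhs => rw [kap]
  simp only [Nat.zero_mod, if_true]
  exact (swp_ne hn _).symm

theorem compat_b (hn : 1 ≤ n) (hr : 1 ≤ r) (hN : ∀ i, IsNorm (N i)) {D : ℕ}
    (hball : ∀ i τ x, N i x < 7 * r → c i τ x = τ)
    (hgood : ∀ i τ, Good (N i) r D (c i τ) (l i τ)) {i : ι} (x y : H i)
    (u v p : List (Σ i, H i)) (huv : N i (x * y⁻¹) + wt N u + wt N v < r)
    (hc : col N r c l (u ++ ⟨i, x⟩ :: p) = col N r c l (v ++ ⟨i, y⟩ :: p)) :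
    lab N r c l (u ++ ⟨i, x⟩ :: p) = lab N r c l (v ++ ⟨i, y⟩ :: p) := by
  have hu := st_append (N := N) (c := c) (l := l) hr u (⟨i, x⟩ :: p) (by omega)
  have hv := st_append (N := N) (c := c) (l := l) hr v (⟨i, y⟩ :: p) (by omega)
  have hcomm := (hN i).comm x y
  by_cases hx : small N r (st N r c l p) ⟨i, x⟩ <;> by_cases hy : small N r (st N r c l p) ⟨i, y⟩
  · have sx := st_small hx
    have sy := st_small hy
    rw [sx] at hu
    rw [sy] at hv
    unfold col at hc
    unfold lab
    rw [hu, hv] at hc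
    rw [hu, hv]
    simp only at hc ⊢
    have l1 := (hN i).lip x y
    have l2 := (hN i).lip y x
    have hq := level_eq hn _ hr (by omega) (by omega) hc
    rw [hq]
    split_ifs with h0
    · rfl
    · have e1 := Nat.div_mul_le_self ((st N r c l p).s + N i x + wt N u) (4 * r)
      rw [hq] at e1
      have e2 := Nat.div_mul_le_self ((st N r c l p).s + N i y + wt N v) (4 * r)
      have t1 : ((st N r c l p).s + N i y + wt N v) / (4 * r) * (4 * r) - r ≤
        (st N r c l (⟨i, x⟩ :: p)).s := by rw [sx]; simp only; omega
      have t2 : ((st N r c l p).s + N i y + wt N v) / (4 * r) * (4 * r) - r ≤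
        (st N r c l (⟨i, y⟩ :: p)).s := by rw [sy]; simp only; omega
      rw [anc_append hr _ u _ (by omega) t1, anc_append hr _ v _ (by omega) t2,
        anc, anc, if_neg (not_lt.mpr t1), if_neg (not_lt.mpr t2)]
  · exact absurd hc (mixed hn hr hN hball x y u v p huv hx hy)
  · exact absurd hc.symm (mixed hn hr hN hball y x v u p (by omega) hy hx)
  · rw [st_big hx] at hu
    rw [st_big hy] at hv
    unfold col at hc
    unfold lab
    rw [hu, hv] at hc
    rw [hu, hv]
    simp only [zero_add] at hc ⊢
    have hq0 : wt N v / (4 * r) = 0 := Nat.div_eq_of_lt (by omega)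
    have hq1 : wt N u / (4 * r) = 0 := Nat.div_eq_of_lt (by omega)
    rw [hq0, hq1] at hc
    rw [hq0, hq1]
    simp only [kap, Nat.zero_mod, if_true] at hc ⊢
    rw [(hgood i _).1 x y (by omega) hc]

theorem compat (hn : 1 ≤ n) (hr : 1 ≤ r) (hN : ∀ i, IsNorm (N i)) {D : ℕ}
    (hball : ∀ i τ x, N i x < 7 * r → c i τ x = τ)
    (hgood : ∀ i τ, Good (N i) r D (c i τ) (l i τ)) {W w : List (Σ i, H i)} {k : ℕ}
    (hk : k < r) (h : Dec N W w k)
    (hc : col N r c l W = col N r c l w) : lab N r c l W = lab N r c l w := by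
  rcases h with ⟨u, v, p, rfl, rfl, h3⟩ | ⟨j, x, y, u, v, p, rfl, rfl, h3⟩
  · exact compat_a hn hr u v p (by omega) hc
  · exact compat_b hn hr hN hball hgood x y u v p (by omega) hc

/-! ### Boundedness -/

variable {G : Type*} [Group G] {NG : G → ℕ} {inc : ∀ i, H i →* G}

def ev (inc : ∀ i, H i →* G) : List (Σ i, H i) → G
  | [] => 1
  | z :: w => inc z.1 z.2 * ev inc w

theorem inv0 (hNG : IsNorm NG) (hinc : ∀ i x, NG (inc i x) ≤ N i x) (w : List (Σ i, H i)) :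
    ((st N r c l w).b = none → NG (ev inc w) ≤ (st N r c l w).s) ∧
    (∀ p i a, (st N r c l w).b = some (p, ⟨i, a⟩) → ∃ x : H i,
      (st N r c l w).j = c i (tau r (st N r c l p)) x ∧ a = l i (tau r (st N r c l p)) x ∧
      NG (ev inc w * (ev inc (⟨i, x⟩ :: p))⁻¹) ≤ (st N r c l w).s) := by
  induction w with
  | nil => simp [st, ev, hNG.one]
  | cons z w ih =>
    have hz := hinc z.1 z.2
    by_cases h : small N r (st N r c l w) z
    · rw [st_small h]
      simp only
      refine ⟨fun hb => ?_, fun p i a hb => ?_⟩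
      · have := ih.1 hb
        have h2 := hNG.mul (inc z.1 z.2) (ev inc w)
        rw [ev]
        omega
      · obtain ⟨x, h1, h2, h3⟩ := ih.2 p i a hb
        refine ⟨x, h1, h2, ?_⟩
        have h4 := hNG.mul (inc z.1 z.2) (ev inc w * (ev inc (⟨i, x⟩ :: p))⁻¹)
        rw [← mul_assoc] at h4
        rw [ev]
        omega
    · rw [st_big h]
      simp only
      refine ⟨fun hb => by simp at hb, fun p i a hb => ?_⟩
      obtain ⟨k, z⟩ := z
      simp only [Option.some.injEq, Prod.mk.injEq] at hb
      obtain ⟨rfl, hb⟩ := hb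
      obtain ⟨rfl, hb⟩ := Sigma.mk.inj hb
      obtain rfl := eq_of_heq hb
      exact ⟨z, rfl, rfl, by simp [hNG.one]⟩

theorem inv1 (hr : 1 ≤ r) (hNG : IsNorm NG) (hinc : ∀ i x, NG (inc i x) ≤ N i x) {T : ℕ} (hT : 0 < T)
    (w : List (Σ i, H i)) :
    ((NG (ev inc w * (ev inc (anc N r c l T w))⁻¹) + (st N r c l (anc N r c l T w)).s
      ≤ (st N r c l w).s) ∧
    (T ≤ (st N r c l w).s → T ≤ (st N r c l (anc N r c l T w)).s + 6 * r)) ∧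
    ((st N r c l w).s < T → anc N r c l T w = w) := by
  induction w with
  | nil => simp [st, anc, hNG.one]; omega
  | cons z w ih =>
    rw [anc]
    split_ifs with h
    · simp [hNG.one]; omega
    · have hs : small N r (st N r c l w) z := by
        by_contra hb
        rw [st_big hb] at h
        simp only at h
        omega
      have e := st_small hs
      have hz := hinc z.1 z.2
      refine ⟨⟨?_, fun _ => ?_⟩, fun h' => absurd h' h⟩
      · have h4 := hNG.mul (inc z.1 z.2) (ev inc w * (ev inc (anc N r c l T w))⁻¹)
        rw [← mul_assoc] at h4
        rw [ev, e]
        have := ih.1.1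
        simp only
        omega
      · by_cases h5 : (st N r c l w).s < T
        · rw [ih.2 h5]
          rw [e] at h
          simp only at h
          unfold small at hs
          have hlow := Nat.div_mul_le_self (st N r c l w).s (4 * r)
          rw [add_mul] at hs
          omega
        · exact ih.1.2 (by omega)

theorem bdd (hr : 1 ≤ r) (hNG : IsNorm NG) (hinc : ∀ i x, NG (inc i x) ≤ N i x) {D : ℕ}
    (hgood : ∀ i τ, Good (N i) r D (c i τ) (l i τ)) {W w : List (Σ i, H i)}
    (hc : col N r c l W = col N r c l w) (hl : lab N r c l W = lab N r c l w) :
    NG (ev inc W * (ev inc w)⁻¹) ≤ D + 22 * r := by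
  unfold lab at hl
  split_ifs at hl with h1 h2 h2
  · have sW : (st N r c l W).s < 4 * r := by
      rcases Nat.div_eq_zero_iff.mp h1 with h | h <;> omega
    have sw : (st N r c l w).s < 4 * r := by
      rcases Nat.div_eq_zero_iff.mp h2 with h | h <;> omega
    unfold col at hc
    rw [h1, h2] at hc
    simp only [kap, Nat.zero_mod, if_true] at hc
    have hl := Sum.inl.inj hl
    have iW := inv0 (N := N) (c := c) (l := l) (r := r) hNG hinc W
    have iw := inv0 (N := N) (c := c) (l := l) (r := r) hNG hinc w
    rcases hb : (st N r c l w).b with _ | ⟨p, i, a⟩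
    · have e1 := iW.1 (hl.trans hb)
      have e2 := iw.1 hb
      have e3 := hNG.mul (ev inc W) (ev inc w)⁻¹
      rw [hNG.inv] at e3
      omega
    · obtain ⟨x, a1, a2, a3⟩ := iW.2 p i a (hl.trans hb)
      obtain ⟨y, b1, b2, b3⟩ := iw.2 p i a hb
      have h6 := (hgood i (tau r (st N r c l p))).2 x y (by rw [← a1, ← b1, hc]) (a2 ▸ b2)
      have h7 := hNG.tri (ev inc W) (ev inc (⟨i, x⟩ :: p)) (ev inc w)
      have h8 := hNG.tri (ev inc (⟨i, x⟩ :: p)) (ev inc (⟨i, y⟩ :: p)) (ev inc w)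
      have h9 := hNG.comm (ev inc w) (ev inc (⟨i, y⟩ :: p))
      have h10 : ev inc (⟨i, x⟩ :: p) * (ev inc (⟨i, y⟩ :: p))⁻¹ = inc i (x * y⁻¹) := by
        simp [ev, mul_assoc]
      have h11 := hinc i (x * y⁻¹)
      rw [← h10] at h11
      omega
  · have hl := Sum.inr.inj hl
    have key : ∀ w : List (Σ i, H i), ¬ (st N r c l w).s / (4 * r) = 0 →
        NG (ev inc w * (ev inc (anc N r c l ((st N r c l w).s / (4 * r) * (4 * r) - r) w))⁻¹)
          ≤ 11 * r := by
      intro w h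
      have hlow := Nat.div_mul_le_self (st N r c l w).s (4 * r)
      have hup := lt_next hr (st N r c l w).s
      rw [add_mul, one_mul] at hup
      have h5 : 1 * (4 * r) ≤ (st N r c l w).s / (4 * r) * (4 * r) :=
        Nat.mul_le_mul_right _ (Nat.one_le_iff_ne_zero.mpr h)
      have := inv1 (N := N) (c := c) (l := l) hr hNG hinc
        (T := (st N r c l w).s / (4 * r) * (4 * r) - r) (by omega) w
      have h6 := this.1.1
      have h7 := this.1.2 (by omega)
      omega
    have k1 := key W h1
    have k2 := key w h2
    rw [hl] at k1
    have k3 := hNG.tri (ev inc W)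
      (ev inc (anc N r c l ((st N r c l w).s / (4 * r) * (4 * r) - r) w)) (ev inc w)
    rw [hNG.comm (ev inc w) (ev inc (anc N r c l ((st N r c l w).s / (4 * r) * (4 * r) - r) w))] at k3
    omega

end words

/-! ### Word norms -/

section wn

variable {G : Type*} [Group G] {S : Set G}

theorem wn_le {l : List G} (h : ∀ x ∈ l, x ∈ S) : wordNorm S l.prod ≤ l.length :=
  Nat.sInf_le ⟨l, rfl, h, rfl⟩

theorem wn_exists (hs : ∀ s ∈ S, s⁻¹ ∈ S) (hg : Subgroup.closure S = ⊤) (g : G) :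
    ∃ l : List G, l.length = wordNorm S g ∧ (∀ x ∈ l, x ∈ S) ∧ l.prod = g := by
  have : {k : ℕ | ∃ l : List G, l.length = k ∧ (∀ x ∈ l, x ∈ S) ∧ l.prod = g}.Nonempty := by
    have hmem : g ∈ (Subgroup.closure S).toSubmonoid := by rw [hg]; trivial
    rw [Subgroup.closure_toSubmonoid] at hmem
    obtain ⟨l, h1, h2⟩ := Submonoid.exists_list_of_mem_closure hmem
    refine ⟨_, l, rfl, fun x hx => ?_, h2⟩
    rcases h1 x hx with h | h
    · exact h
    · simpa using hs _ h
  exact Nat.sInf_mem this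

theorem wn_norm (hs : ∀ s ∈ S, s⁻¹ ∈ S) (hg : Subgroup.closure S = ⊤) : IsNorm (wordNorm S) := by
  have hinv : ∀ x, wordNorm S x⁻¹ ≤ wordNorm S x := by
    intro x
    obtain ⟨l, h1, h2, rfl⟩ := wn_exists hs hg x
    rw [← h1, List.prod_inv_reverse]
    refine (wn_le ?_).trans (by simp)
    intro y hy
    simp only [List.mem_reverse, List.mem_map] at hy
    obtain ⟨z, hz, rfl⟩ := hy
    exact hs _ (h2 z hz)
  refine ⟨?_, ?_, fun x => le_antisymm (hinv x) (by simpa using hinv x⁻¹)⟩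
  · simpa using wn_le (S := S) (l := []) (by simp)
  · intro x y
    obtain ⟨l, h1, h2, rfl⟩ := wn_exists hs hg x
    obtain ⟨m, h3, h4, rfl⟩ := wn_exists hs hg y
    rw [← h1, ← h3, ← List.prod_append, ← List.length_append]
    refine wn_le fun z hz => ?_
    rcases List.mem_append.mp hz with h | h
    · exact h2 z h
    · exact h4 z h

theorem good_of_asdim {m n : ℕ} (hmn : m ≤ n)
    (h : AsdimLE (fun g h : G => wordDist S g h) m) (r : ℕ) (hr : 1 ≤ r) :
    ∃ (D : ℕ) (c : G → Fin (n + 1)) (l : G → Set G), Good (wordNorm S) r D c l := by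
  obtain ⟨U, D, h1, h2, h3⟩ := h r (by exact_mod_cast hr)
  choose c l hU hl using h3
  refine ⟨⌈D⌉₊, fun x => Fin.castLE (by omega) (c x⁻¹), fun x => l x⁻¹, ?_, ?_⟩
  · intro x y hxy hc
    have hc : c x⁻¹ = c y⁻¹ := Fin.castLE_injective _ hc
    by_contra hne
    have := h1 (c x⁻¹) (l x⁻¹) (hU _) (l y⁻¹) (hc ▸ hU _) hne _ (hl _) _ (hl _)
    simp only [wordDist, inv_inv] at this
    have : r ≤ wordNorm S (x * y⁻¹) := by exact_mod_cast this
    omega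
  · intro x y hc hll
    have hc : c x⁻¹ = c y⁻¹ := Fin.castLE_injective _ hc
    have := h2 (c x⁻¹) (l x⁻¹) (hU _) x⁻¹ (hl _) y⁻¹ (by simp only at hll; rw [hll]; exact hl _)
    simp only [wordDist, inv_inv] at this
    exact_mod_cast this.trans (Nat.le_ceil D)

theorem asdim_of_good {n : ℕ} {L : Type*}
    (h : ∀ r : ℕ, 1 ≤ r → ∃ (D : ℕ) (c : G → Fin (n + 1)) (l : G → L), Good (wordNorm S) r D c l) :
    AsdimLE (fun g h : G => wordDist S g h) n := by
  intro r hr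
  obtain ⟨D, c, l, h1, h2⟩ := h ⌈r⌉₊ (Nat.one_le_ceil_iff.mpr hr)
  refine ⟨fun i => {V | ∃ a, V = {x | c x⁻¹ = i ∧ l x⁻¹ = a}}, D, ?_, ?_, ?_⟩
  · rintro i _ ⟨a, rfl⟩ _ ⟨b, rfl⟩ hne x ⟨hx, hx'⟩ y ⟨hy, hy'⟩
    by_contra hlt
    push Not at hlt
    apply hne
    have : a = b := by
      rw [← hx', ← hy']
      apply h1 _ _ _ (hx.trans hy.symm)
      simp only [wordDist] at hlt
      rw [inv_inv]
      exact_mod_cast hlt.trans_le (Nat.le_ceil r)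
    rw [this]
  · rintro i _ ⟨a, rfl⟩ x ⟨hx, hx'⟩ y ⟨hy, hy'⟩
    have := h2 x⁻¹ y⁻¹ (hx.trans hy.symm) (hx'.trans hy'.symm)
    rw [inv_inv] at this
    simp only [wordDist]
    exact_mod_cast this
  · intro x
    exact ⟨c x⁻¹, _, ⟨l x⁻¹, rfl⟩, rfl, rfl⟩

theorem asdim_mem {d : G → G → ℝ} (h : asDim d ≠ ⊤) : ∃ m : ℕ, asDim d = m ∧ AsdimLE d m := by
  have hne : {N : ℕ∞ | ∃ n : ℕ, N = (n : ℕ∞) ∧ AsdimLE d n}.Nonempty := by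
    by_contra hemp
    rw [Set.not_nonempty_iff_eq_empty] at hemp
    apply h
    rw [asDim, hemp, sInf_empty]
  exact csInf_mem hne

end wn

/-! ### The free product -/

section main

open Monoid

universe u v

/-- The two factors, lifted to a common universe. -/
def Fam (A : Type u) (B : Type v) : Bool → Type (max u v)
  | true => ULift.{v} A
  | false => ULift.{u} B

instance famGroup (A : Type u) (B : Type v) [Group A] [Group B] : ∀ i, Group (Fam A B i)
  | true => inferInstanceAs (Group (ULift.{v} A))
  | false => inferInstanceAs (Group (ULift.{u} B))

variable {A : Type u} {B : Type v} [Group A] [Group B]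

def incl : ∀ i, Fam A B i →* Coprod A B
  | true => (Coprod.inl : A →* Coprod A B).comp (MulEquiv.ulift : ULift.{v} A ≃* A).toMonoidHom
  | false => (Coprod.inr : B →* Coprod A B).comp (MulEquiv.ulift : ULift.{u} B ≃* B).toMonoidHom

def toI : Coprod A B →* CoprodI (Fam A B) :=
  Coprod.lift
    ((CoprodI.of (M := Fam A B) (i := true)).comp
      (MulEquiv.ulift : ULift.{v} A ≃* A).symm.toMonoidHom)
    ((CoprodI.of (M := Fam A B) (i := false)).comp
      (MulEquiv.ulift : ULift.{u} B ≃* B).symm.toMonoidHom)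

def fromI : CoprodI (Fam A B) →* Coprod A B := CoprodI.lift incl

theorem fromI_toI (g : Coprod A B) : fromI (toI g) = g := by
  have : (fromI.comp toI : Coprod A B →* Coprod A B) = MonoidHom.id _ := by
    apply Coprod.hom_ext
    · ext a
      simp only [MonoidHom.comp_apply, toI, Coprod.lift_apply_inl, fromI]
      exact CoprodI.lift_of ..
    · ext a
      simp only [MonoidHom.comp_apply, toI, Coprod.lift_apply_inr, fromI]
      exact CoprodI.lift_of ..
  exact DFunLike.congr_fun this g

theorem toI_incl (i : Bool) (x : Fam A B i) : toI (incl i x) = CoprodI.of x := by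
  cases i <;> simp [incl, toI] <;> rfl

open Classical in
noncomputable def nf (g : Coprod A B) : List (Σ i, Fam A B i) :=
  (toI g • (CoprodI.Word.empty : CoprodI.Word (Fam A B))).toList

theorem ev_eq (w : List (Σ i, Fam A B i)) :
    ev incl w = fromI (w.map fun z => CoprodI.of z.2).prod := by
  induction w with
  | nil => simp [ev]
  | cons z w ih => simp [ev, ih, fromI]

theorem ev_nf (g : Coprod A B) : ev incl (nf g) = g := by
  classical
  rw [ev_eq]
  have : ((nf g).map fun z => CoprodI.of z.2).prod = toI g := by
    have h := CoprodI.Word.prod_smul (toI g) (CoprodI.Word.empty : CoprodI.Word (Fam A B))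
    rw [CoprodI.Word.prod_empty, mul_one] at h
    rw [← h, CoprodI.Word.prod, nf]
  rw [this, fromI_toI]

theorem rcons_toList [DecidableEq Bool] [∀ i, DecidableEq (Fam A B i)] {i : Bool}
    (p : CoprodI.Word.Pair (Fam A B) i) :
    (CoprodI.Word.rcons p).toList = pk i p.head p.tail.toList := by
  unfold CoprodI.Word.rcons pk
  split_ifs <;> simp [CoprodI.Word.cons]

theorem nf_step (i : Bool) (s : Fam A B i) (g : Coprod A B) :
    ∃ a t, nf g = pk i a t ∧ nf (incl i s * g) = pk i (s * a) t := by
  classical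
  let w : CoprodI.Word (Fam A B) := toI g • CoprodI.Word.empty
  refine ⟨(CoprodI.Word.equivPair i w).head, (CoprodI.Word.equivPair i w).tail.toList, ?_, ?_⟩
  · rw [← rcons_toList, ← CoprodI.Word.equivPair_symm, Equiv.symm_apply_apply]
    simp only [w, nf]
  · have := CoprodI.Word.of_smul_def i w s
    have h2 := congrArg CoprodI.Word.toList this
    rw [rcons_toList] at h2
    rw [← h2, nf, map_mul, mul_smul, toI_incl]


theorem dec_nf {N : ∀ i, Fam A B i → ℕ} (hN : ∀ i, IsNorm (N i)) {S : Set (Coprod A B)}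
    (hS : ∀ s ∈ S, ∃ i x, s = incl i x ∧ N i x ≤ 1) (h : Coprod A B) (l : List (Coprod A B))
    (hl : ∀ s ∈ l, s ∈ S) : Dec N (nf (l.prod * h)) (nf h) l.length := by
  induction l with
  | nil => exact Or.inl ⟨[], [], nf h, by simp, by simp, by simp [wt]⟩
  | cons s l ih =>
    have ih := ih fun t ht => hl t (List.mem_cons_of_mem _ ht)
    obtain ⟨i, x, rfl, hx⟩ := hS s (hl s List.mem_cons_self)
    obtain ⟨a, t, h1, h2⟩ := nf_step i x (l.prod * h)
    rw [List.prod_cons, mul_assoc, h2, List.length_cons]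
    rw [h1] at ih
    exact dec_step hN hx ih

noncomputable def famNorm (SA : Set A) (SB : Set B) : ∀ i, Fam A B i → ℕ
  | true => fun x : ULift.{v} A => wordNorm SA x.down
  | false => fun x : ULift.{u} B => wordNorm SB x.down

theorem wn_gen {G : Type*} [Group G] {S : Set G} {s : G} (h : s ∈ S) : wordNorm S s ≤ 1 := by
  simpa using wn_le (S := S) (l := [s]) (by simpa using h)

theorem wn_map {G K : Type*} [Group G] [Group K] {S : Set G} {T : Set K} (f : G →* K)
    (hs : ∀ s ∈ S, s⁻¹ ∈ S) (hg : Subgroup.closure S = ⊤) (hf : ∀ s ∈ S, f s ∈ T) (g : G) :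
    wordNorm T (f g) ≤ wordNorm S g := by
  obtain ⟨l, h1, h2, rfl⟩ := wn_exists hs hg g
  rw [← h1, map_list_prod, ← List.length_map (f := f)]
  refine wn_le fun x hx => ?_
  obtain ⟨y, hy, rfl⟩ := List.mem_map.mp hx
  exact hf _ (h2 y hy)

theorem main_le (SA : Set A) (SB : Set B)
    (hSAsymm : ∀ s ∈ SA, s⁻¹ ∈ SA) (hSBsymm : ∀ s ∈ SB, s⁻¹ ∈ SB)
    (hSAgen : Subgroup.closure SA = ⊤) (hSBgen : Subgroup.closure SB = ⊤) {a b n : ℕ}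
    (ha : AsdimLE (fun g h : A => wordDist SA g h) a)
    (hb : AsdimLE (fun g h : B => wordDist SB g h) b) (han : a ≤ n) (hbn : b ≤ n) (hn : 1 ≤ n) :
    AsdimLE (fun g h : Coprod A B =>
      wordDist ((Coprod.inl '' SA) ∪ (Coprod.inr '' SB)) g h) n := by
  set S : Set (Coprod A B) := (Coprod.inl '' SA) ∪ (Coprod.inr '' SB) with hS
  have hsymm : ∀ s ∈ S, s⁻¹ ∈ S := by
    rintro _ (⟨s, hs, rfl⟩ | ⟨s, hs, rfl⟩)
    · exact Or.inl ⟨s⁻¹, hSAsymm s hs, by simp⟩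
    · exact Or.inr ⟨s⁻¹, hSBsymm s hs, by simp⟩
  have hgen : Subgroup.closure S = ⊤ := by
    rw [hS, Subgroup.closure_union, ← MonoidHom.map_closure, ← MonoidHom.map_closure, hSAgen, hSBgen,
      ← MonoidHom.range_eq_map, ← MonoidHom.range_eq_map]
    exact Coprod.range_inl_sup_range_inr
  have hNG := wn_norm hsymm hgen
  have nA := wn_norm hSAsymm hSAgen
  have nB := wn_norm hSBsymm hSBgen
  have hN : ∀ i, IsNorm (famNorm SA SB i) := by
    rintro (_ | _)
    · exact ⟨nB.one, fun x y => nB.mul _ _, fun x => nB.inv _⟩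
    · exact ⟨nA.one, fun x y => nA.mul _ _, fun x => nA.inv _⟩
  have hinc : ∀ i x, wordNorm S (incl i x) ≤ famNorm SA SB i x := by
    rintro (_ | _) x
    · exact wn_map (T := S) Coprod.inr hSBsymm hSBgen (fun s hs => Or.inr ⟨s, hs, rfl⟩) _
    · exact wn_map (T := S) Coprod.inl hSAsymm hSAgen (fun s hs => Or.inl ⟨s, hs, rfl⟩) _
  have hSl : ∀ s ∈ S, ∃ i x, s = incl i x ∧ famNorm SA SB i x ≤ 1 := by
    rintro _ (⟨s, hs, rfl⟩ | ⟨s, hs, rfl⟩)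
    · exact ⟨true, (ULift.up s : ULift.{v} A), rfl, wn_gen hs⟩
    · exact ⟨false, (ULift.up s : ULift.{u} B), rfl, wn_gen hs⟩
  let L : Bool → Type (max u v) := fun i => Option (Set (Fam A B i))
  refine asdim_of_good (L := Option (List (Σ i, Fam A B i) × Σ i, L i) ⊕ List (Σ i, Fam A B i))
    fun r hr => ?_
  have hbase : ∀ i, ∃ (D : ℕ) (c : Fam A B i → Fin (n + 1)) (l : Fam A B i → Set (Fam A B i)),
      Good (famNorm SA SB i) r D c l := by
    rintro (_ | _)
    · obtain ⟨D, c, l, h1, h2⟩ := good_of_asdim hbn hb r hr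
      refine ⟨D, fun x : ULift.{u} B => c x.down, fun x : ULift.{u} B => ULift.down ⁻¹' l x.down,
        fun x y hxy hc => ?_, fun x y hc hl => h2 _ _ hc ?_⟩
      · exact congrArg _ (h1 _ _ hxy hc)
      · exact ULift.down_surjective.preimage_injective hl
    · obtain ⟨D, c, l, h1, h2⟩ := good_of_asdim han ha r hr
      refine ⟨D, fun x : ULift.{v} A => c x.down, fun x : ULift.{v} A => ULift.down ⁻¹' l x.down,
        fun x y hxy hc => ?_, fun x y hc hl => h2 _ _ hc ?_⟩
      · exact congrArg _ (h1 _ _ hxy hc)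
      · exact ULift.down_surjective.preimage_injective hl
  choose D c0 l0 h0 using hbase
  have hmod := fun i => good_mod (hN i) (h0 i) (7 * r)
  choose c l hcl using hmod
  have hball : ∀ i τ x, famNorm SA SB i x < 7 * r → c i τ x = τ := fun i τ => (hcl i τ).1
  have hgood : ∀ i τ, Good (famNorm SA SB i) r (2 * (7 * r + (D true + D false) + r))
      (c i τ) (l i τ) := by
    intro i τ
    refine ⟨(hcl i τ).2.1, fun x y h1 h2 => ((hcl i τ).2.2 x y h1 h2).trans ?_⟩
    cases i <;> omega
  refine ⟨2 * (7 * r + (D true + D false) + r) + 22 * r,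
    fun g => col (famNorm SA SB) r c l (nf g),
    fun g => lab (L := L) (famNorm SA SB) r c l (nf g), ?_, ?_⟩
  · intro x y hxy hc
    obtain ⟨m, h1, h2, h3⟩ := wn_exists hsymm hgen (x * y⁻¹)
    have h4 := dec_nf hN hSl y m h2
    rw [h3, inv_mul_cancel_right, h1] at h4
    exact compat hn hr hN hball hgood hxy h4 hc
  · intro x y hc hl
    have := bdd (inc := incl) hr hNG hinc hgood hc hl
    rwa [ev_nf, ev_nf] at this

end main

end AsdimFree

/-- **Corollary (free products).** For finitely generated groups `A` and `B`,
`asdim (A * B) ≤ max {asdim A, asdim B, 1}`, where the free product `A * B`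
carries the word metric of the union of finite symmetric generating sets of
`A` and `B` (embedded via the canonical inclusions). -/
theorem asdim_free_product_le {A B : Type*} [Group A] [Group B]
    (SA : Set A) (SB : Set B) (hSAfin : SA.Finite) (hSBfin : SB.Finite)
    (hSAsymm : ∀ s ∈ SA, s⁻¹ ∈ SA) (hSBsymm : ∀ s ∈ SB, s⁻¹ ∈ SB)
    (hSAgen : Subgroup.closure SA = ⊤) (hSBgen : Subgroup.closure SB = ⊤) :
    asDim (fun g h : Monoid.Coprod A B =>
        wordDist ((Monoid.Coprod.inl '' SA) ∪ (Monoid.Coprod.inr '' SB)) g h) ≤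
      max (max (asDim (fun a a' : A => wordDist SA a a'))
               (asDim (fun b b' : B => wordDist SB b b'))) 1 := by
  by_cases hA : asDim (fun a a' : A => wordDist SA a a') = ⊤
  · simp [hA]
  by_cases hB : asDim (fun b b' : B => wordDist SB b b') = ⊤
  · simp [hB]
  obtain ⟨a, ea, ha⟩ := AsdimFree.asdim_mem hA
  obtain ⟨b, eb, hb⟩ := AsdimFree.asdim_mem hB
  rw [ea, eb]
  have h := AsdimFree.main_le SA SB hSAsymm hSBsymm hSAgen hSBgen ha hb
    (n := max (max a b) 1) (by simp) (by simp) (by simp)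
  have h2 : asDim (fun g h : Monoid.Coprod A B =>
      wordDist ((Monoid.Coprod.inl '' SA) ∪ (Monoid.Coprod.inr '' SB)) g h) ≤
      ((max (max a b) 1 : ℕ) : ℕ∞) := sInf_le ⟨_, rfl, h⟩
  refine h2.trans ?_
  simp
  omega
end
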